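/- Let {X_t(n)} satisfy HL0–HL2, HL4 and HL6–HL9, and let K : ℝ → ℝ∪{±∞} be such that K and K² are Lebesgue integrable. Suppose (i) {h_n} is a positive sequence with β_n^{−1}h_n + β_n(n h_n)^{−1} → 0, and (ii) for each x ∈ ℝ and t₀ as in HL7, (β_n/(n h_n)) Σ_{t=1}^{t₀−1} K((X_t(n) − x)/h_n) → 0 in probability. Then (β_n/(h_n n)) Σ_{t=1}^n K((X_t(n) − x)/h_n) converges in distribution to Φ_{X⁺}(−X⁻) ∫_ℝ K(u) du. -/

import Mathlib

open MeasureTheory ProbabilityTheory Filter Topology Finset BoundedContinuousFunction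

section ConditionalDensity

/-- A conditional density that acts correctly on bounded test functions is, almost surely, an
integrable nonnegative density of the regular conditional distribution. -/
lemma condDistrib_ae_eq_withDensity {Ω T : Type*} [MeasurableSpace Ω] [mT : MeasurableSpace T]
    (μ : Measure Ω) [IsProbabilityMeasure μ] {π : Ω → T} (hπ : Measurable π)
    {Y : Ω → ℝ} (hY : Measurable Y) {D : Ω → ℝ → ℝ}
    (hD : ∀ ψ : ℝ → ℝ, Measurable ψ → (∃ C, ∀ y, |ψ y| ≤ C) →
      μ[fun ω => ψ (Y ω) | mT.comap π] =ᵐ[μ] fun ω => ∫ y, ψ y * D ω y) :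
    ∀ᵐ ω ∂μ, Integrable (D ω) ∧ 0 ≤ᵐ[volume] D ω ∧
      condDistrib Y π μ (π ω) = volume.withDensity fun y => ENNReal.ofReal (D ω y) := by
  have h1 : ∀ᵐ ω ∂μ, Integrable (D ω) ∧ ∫ y, D ω y = 1 := by
    have h := hD (fun _ => 1) measurable_const ⟨1, by simp⟩
    rw [condExp_const (hπ.comap_le)] at h
    filter_upwards [h] with ω hω
    simp only [one_mul] at hω
    refine ⟨?_, hω.symm⟩
    by_contra hn
    rw [integral_undef hn] at hω
    exact one_ne_zero hω
  have h2 : ∀ᵐ ω ∂μ, ∀ q : ℚ, (condDistrib Y π μ (π ω)).real (Set.Iic (q : ℝ))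
      = ∫ y in Set.Iic (q : ℝ), D ω y := by
    rw [ae_all_iff]
    intro q
    have h := hD ((Set.Iic (q : ℝ)).indicator fun _ => 1)
      (measurable_const.indicator measurableSet_Iic)
      ⟨1, fun y => by by_cases hy : y ∈ Set.Iic (q : ℝ) <;> simp [hy]⟩
    have h' := condDistrib_ae_eq_condExp (μ := μ) hπ hY (measurableSet_Iic (a := (q : ℝ)))
    filter_upwards [h, h'] with ω hω hω'
    rw [hω']
    have e1 : (fun ω => (Set.Iic (q : ℝ)).indicator (fun _ => (1 : ℝ)) (Y ω))
        = (Y ⁻¹' Set.Iic (q : ℝ)).indicator fun _ => (1 : ℝ) := by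
      ext ω; rfl
    rw [e1] at hω
    rw [hω, ← integral_indicator measurableSet_Iic]
    congr 1
    ext y
    by_cases hy : y ∈ Set.Iic (q : ℝ) <;> simp [hy]
  filter_upwards [h1, h2] with ω ⟨hi, hone⟩ hq
  set κ := condDistrib Y π μ (π ω) with hκ
  have hpos : IsFiniteMeasure (volume.withDensity fun y => ENNReal.ofReal (D ω y)) :=
    isFiniteMeasure_withDensity_ofReal hi.2
  have hneg : IsFiniteMeasure (volume.withDensity fun y => ENNReal.ofReal (-D ω y)) :=
    isFiniteMeasure_withDensity_ofReal hi.neg.2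
  have hset : ∀ s : Set ℝ, MeasurableSet s →
      ((volume.withDensity fun y => ENNReal.ofReal (D ω y)) s).toReal
        - ((volume.withDensity fun y => ENNReal.ofReal (-D ω y)) s).toReal
      = ∫ y in s, D ω y := by
    intro s hs
    rw [withDensity_apply _ hs, withDensity_apply _ hs,
      integral_eq_lintegral_pos_part_sub_lintegral_neg_part hi.integrableOn]
  have heq : κ + (volume.withDensity fun y => ENNReal.ofReal (-D ω y))
      = volume.withDensity fun y => ENNReal.ofReal (D ω y) := by
    have hIic : ∀ q : ℚ, (κ + (volume.withDensity fun y => ENNReal.ofReal (-D ω y)))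
        (Set.Iic (q : ℝ)) = (volume.withDensity fun y => ENNReal.ofReal (D ω y))
        (Set.Iic (q : ℝ)) := by
      intro q
      have := hset _ (measurableSet_Iic (a := (q : ℝ)))
      rw [← hq q, Measure.real] at this
      rw [Measure.add_apply, ← ENNReal.toReal_eq_toReal_iff' (by finiteness) (by finiteness),
        ENNReal.toReal_add (by finiteness) (by finiteness)]
      linarith
    refine ext_of_generate_finite _ (BorelSpace.measurable_eq.trans
      Real.borel_eq_generateFrom_Iic_rat) Real.isPiSystem_Iic_rat ?_ ?_
    · intro s hs
      obtain ⟨q, rfl⟩ := Set.mem_iUnion.1 hs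
      exact hIic q
    · have := hset Set.univ MeasurableSet.univ
      rw [setIntegral_univ, hone] at this
      rw [Measure.add_apply, ← ENNReal.toReal_eq_toReal_iff' (by finiteness) (by finiteness),
        ENNReal.toReal_add (by finiteness) (by finiteness), measure_univ, ENNReal.toReal_one]
      linarith
  have hnn : 0 ≤ᵐ[volume] D ω := by
    refine ae_nonneg_of_forall_setIntegral_nonneg hi fun s hs _ => ?_
    rw [← hset s hs, ← heq, Measure.add_apply, ENNReal.toReal_add (by finiteness) (by finiteness)]
    simp
  refine ⟨hi, hnn, ?_⟩
  rw [← heq]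
  have : (volume.withDensity fun y => ENNReal.ofReal (-D ω y)) = 0 := by
    rw [withDensity_congr_ae (g := 0), withDensity_zero]
    filter_upwards [hnn] with y hy
    simpa using hy
  rw [this, add_zero]

/-- If the conditional density of `Y` given `π` is at most `C`, then the conditional law of `Y` is
dominated by `C` times Lebesgue measure. -/
lemma lintegral_prod_le_of_condDensity_le {Ω T : Type*} [MeasurableSpace Ω]
    [mT : MeasurableSpace T] (μ : Measure Ω) [IsProbabilityMeasure μ] {π : Ω → T}
    (hπ : Measurable π) {Y : Ω → ℝ} (hY : Measurable Y) {D : Ω → ℝ → ℝ}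
    (hD : ∀ ψ : ℝ → ℝ, Measurable ψ → (∃ C, ∀ y, |ψ y| ≤ C) →
      μ[fun ω => ψ (Y ω) | mT.comap π] =ᵐ[μ] fun ω => ∫ y, ψ y * D ω y)
    {C : ℝ} (hC : ∀ ω y, D ω y ≤ C) {f : T × ℝ → ENNReal} (hf : Measurable f) :
    ∫⁻ ω, f (π ω, Y ω) ∂μ ≤ ENNReal.ofReal C * ∫⁻ ω, (∫⁻ y, f (π ω, y)) ∂μ := by
  have h1 : ∫⁻ ω, f (π ω, Y ω) ∂μ = ∫⁻ ω, ∫⁻ y, f (π ω, y) ∂(condDistrib Y π μ (π ω)) ∂μ := by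
    rw [← lintegral_map (f := f) (g := fun ω => (π ω, Y ω)) hf (hπ.prodMk hY),
      ← compProd_map_condDistrib hY.aemeasurable, Measure.lintegral_compProd hf,
      lintegral_map (Measurable.lintegral_kernel_prod_right' hf) hπ]
  rw [h1, ← lintegral_const_mul' _ _ ENNReal.ofReal_ne_top]
  refine lintegral_mono_ae ?_
  filter_upwards [condDistrib_ae_eq_withDensity μ hπ hY hD] with ω hω
  rw [hω.2.2, ← lintegral_const_mul' _ _ ENNReal.ofReal_ne_top,
    lintegral_withDensity_eq_lintegral_mul₀ hω.1.aemeasurable.ennreal_ofReal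
      (g := fun y => f (π ω, y)) (hf.comp measurable_prodMk_left).aemeasurable]
  exact lintegral_mono fun y => mul_le_mul_left (ENNReal.ofReal_le_ofReal (hC ω y)) _

lemma lintegral_affine (f : ℝ → ENNReal) (x : ℝ) {b : ℝ} (hb : 0 < b) (hf : Measurable f) :
    ∫⁻ y, f (x + b * y) = ENNReal.ofReal b⁻¹ * ∫⁻ z, f z := by
  have h1 : ∫⁻ z, f z = ∫⁻ z, f (x + z) := (lintegral_add_left_eq_self f x).symm
  have h2 := Real.smul_map_volume_mul_left hb.ne'
  have h3 : Measurable fun z => f (x + z) := by fun_prop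
  have h4 : ∫⁻ z, f (x + z) = ENNReal.ofReal |b| * ∫⁻ y, f (x + b * y) := by
    conv_lhs => rw [← h2]
    rw [lintegral_smul_measure, lintegral_map h3 (by fun_prop), smul_eq_mul]
  rw [h1, h4, ← mul_assoc, ← ENNReal.ofReal_mul (by positivity), abs_of_pos hb, inv_mul_cancel₀ hb.ne', ENNReal.ofReal_one,
    one_mul]

lemma integral_affine (f : ℝ → ℝ) (x : ℝ) {b : ℝ} (hb : 0 < b) :
    ∫ y, f (x + b * y) = b⁻¹ * ∫ z, f z := by
  rw [Measure.integral_comp_mul_left (fun z => f (x + z)) b, integral_add_left_eq_self,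
    abs_of_pos (inv_pos.2 hb), smul_eq_mul]

lemma integrable_affine {f : ℝ → ℝ} (hf : Integrable f) (x : ℝ) {b : ℝ} (hb : 0 < b) :
    Integrable fun y => f (x + b * y) :=
  (hf.comp_add_left x).comp_mul_left' hb.ne'

/-- Joint-law form of the domination of the conditional law of the scaled increment. -/
lemma lintegral_pair_le {Ω : Type*} {m' m : MeasurableSpace Ω} (hm : m' ≤ m)
    (μ : Measure Ω) [IsProbabilityMeasure μ] {X Z : Ω → ℝ} (hX : Measurable[m'] X)
    (hZ : Measurable Z) {b : ℝ} (hb : 0 < b) {D : Ω → ℝ → ℝ}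
    (hD : ∀ ψ : ℝ → ℝ, Measurable ψ → (∃ C, ∀ y, |ψ y| ≤ C) →
      μ[fun ω => ψ (b⁻¹ * (Z ω - X ω)) | m'] =ᵐ[μ] fun ω => ∫ y, ψ y * D ω y)
    {C : ℝ} (hC : ∀ ω y, D ω y ≤ C) {f : ℝ × ℝ → ENNReal} (hf : Measurable f) :
    ∫⁻ ω, f (X ω, Z ω) ∂μ ≤ ENNReal.ofReal (C / b) * ∫⁻ ω, (∫⁻ z, f (X ω, z)) ∂μ := by
  have hXm : Measurable X := hX.mono hm le_rfl
  have key := lintegral_prod_le_of_condDensity_le (mT := m') μ (π := id) (measurable_id'' hm)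
    (Y := fun ω => b⁻¹ * (Z ω - X ω)) (by fun_prop) (D := D)
    (by simpa only [MeasurableSpace.comap_id] using hD) hC
    (f := fun p => f (X p.1, X p.1 + b * p.2))
    (by
      have h1 : Measurable[m'.prod inferInstance] fun p : Ω × ℝ => X p.1 :=
        hX.comp (@measurable_fst Ω ℝ m' _)
      have h2 : Measurable[m'.prod inferInstance] fun p : Ω × ℝ => p.2 := @measurable_snd Ω ℝ m' _
      exact hf.comp (h1.prodMk (h1.add (h2.const_mul b))))
  calc ∫⁻ ω, f (X ω, Z ω) ∂μ
      = ∫⁻ ω, f (X ω, X ω + b * (b⁻¹ * (Z ω - X ω))) ∂μ := by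
        simp only [mul_inv_cancel_left₀ hb.ne', add_sub_cancel]
    _ ≤ ENNReal.ofReal C * ∫⁻ ω, (∫⁻ y, f (X ω, X ω + b * y)) ∂μ := key
    _ = ENNReal.ofReal (C / b) * ∫⁻ ω, (∫⁻ z, f (X ω, z)) ∂μ := by
        have : ∀ ω, ∫⁻ y, f (X ω, X ω + b * y) = ENNReal.ofReal b⁻¹ * ∫⁻ z, f (X ω, z) :=
          fun ω => lintegral_affine (fun z => f (X ω, z)) (X ω) hb (by fun_prop)
        simp only [this]
        rw [lintegral_const_mul' _ _ ENNReal.ofReal_ne_top, ← mul_assoc,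
          ← ENNReal.ofReal_mul' (by positivity), div_eq_mul_inv]

/-- The effect of local flatness of the conditional density on a mean-zero test function. -/
lemma abs_integral_mean_zero_le {D A : ℝ → ℝ} (hDi : Integrable D) (hD0 : 0 ≤ᵐ[volume] D) {C : ℝ}
    (hC : ∀ y, D y ≤ C) (hA : Integrable A) (hA0 : ∫ z, A z = 0) {b r ρ ε : ℝ} (hb : 0 < b)
    (hρ : 0 < ρ) (hrb : 2 * r ≤ ρ * b) (hε : 0 ≤ ε)
    (hosc : ∀ y, |y| ≤ ρ → |D y - D 0| ≤ ε) {x : ℝ} (hx : |x| ≤ r) :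
    |∫ y, A (x + b * y) * D y| ≤
      b⁻¹ * (ε * (∫ z, |A z|) + (2 * C + ε) * ∫ z, {z | r < |z|}.indicator (fun z => |A z|) z) := by
  have hpos : ∃ y, |y| ≤ ρ ∧ 0 ≤ D y := by
    have h1 : 0 < volume (Metric.ball (0 : ℝ) ρ) := Metric.measure_ball_pos _ _ hρ
    obtain ⟨y, hy, hy'⟩ := (Frequently.and_eventually (frequently_ae_mem_iff.2 h1.ne') hD0).exists
    refine ⟨y, ?_, hy'⟩
    simpa using (Metric.mem_ball.1 hy).le
  obtain ⟨y₀, hy₀, hDy₀⟩ := hpos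
  have hD0l : -ε ≤ D 0 := by
    have := (abs_le.1 (hosc y₀ hy₀)).2
    linarith
  have hAa := integrable_affine hA x hb
  have hAD : Integrable fun y => A (x + b * y) * D y := by
    refine hAa.mul_bdd (c := C) hDi.1 ?_
    filter_upwards [hD0] with y hy
    rw [Real.norm_eq_abs, abs_of_nonneg hy]
    exact hC y
  have hms : MeasurableSet {z : ℝ | r < |z|} := measurableSet_lt measurable_const (by fun_prop)
  have hT : Integrable ({z : ℝ | r < |z|}.indicator fun z => |A z|) := hA.abs.indicator hms
  have e1 : ∫ y, A (x + b * y) * D y = ∫ y, A (x + b * y) * (D y - D 0) := by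
    simp only [mul_sub]
    rw [integral_sub hAD (hAa.mul_const _), integral_mul_const, integral_affine A x hb, hA0]
    simp
  rw [e1]
  calc |∫ y, A (x + b * y) * (D y - D 0)|
      ≤ ∫ y, (ε * |A (x + b * y)|
          + (2 * C + ε) * {z : ℝ | r < |z|}.indicator (fun z => |A z|) (x + b * y)) := by
        rw [← Real.norm_eq_abs]
        refine norm_integral_le_of_norm_le ((((integrable_affine hA x hb).abs).const_mul _).add
          ((integrable_affine hT x hb).const_mul _)) ?_
        filter_upwards [hD0] with y hy
        rw [Real.norm_eq_abs, abs_mul]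
        by_cases hz : r < |x + b * y|
        · rw [Set.indicator_of_mem (by exact hz)]
          have : |D y - D 0| ≤ 2 * C + 2 * ε := by
            rw [abs_le]
            simp only [Pi.zero_apply] at hy
            constructor <;> linarith [hC y, hC 0]
          nlinarith [abs_nonneg (A (x + b * y))]
        · rw [Set.indicator_of_notMem (by exact hz), mul_zero, add_zero, mul_comm]
          refine mul_le_mul_of_nonneg_right (hosc y ?_) (abs_nonneg _)
          have h1 : b * |y| ≤ 2 * r := by
            calc b * |y| = |b * y| := by rw [abs_mul, abs_of_pos hb]
              _ = |(x + b * y) - x| := by ring_nf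
              _ ≤ |x + b * y| + |x| := abs_sub _ _
              _ ≤ 2 * r := by linarith [not_lt.1 hz]
          nlinarith
    _ = _ := by
        rw [integral_add ((((integrable_affine hA x hb).abs).const_mul _))
          ((integrable_affine hT x hb).const_mul _), integral_const_mul, integral_const_mul,
          integral_affine (fun z => |A z|) x hb, integral_affine _ x hb]
        ring

lemma integrable_comp_of_law_le {Ω : Type*} [MeasurableSpace Ω] {μ : Measure Ω} {X : Ω → ℝ}
    (hX : Measurable X) {c : ℝ} (hc : 0 ≤ c)
    (hlaw : ∀ f : ℝ → ENNReal, Measurable f →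
      ∫⁻ ω, f (X ω) ∂μ ≤ ENNReal.ofReal c * ∫⁻ z, f z)
    {H : ℝ → ℝ} (hHm : Measurable H) (hH : Integrable H) :
    Integrable (fun ω => H (X ω)) μ ∧ ∫ ω, |H (X ω)| ∂μ ≤ c * ∫ z, |H z| := by
  have h1 := hlaw (fun z => ‖H z‖ₑ) (by fun_prop)
  have h2 : ∫⁻ z, ‖H z‖ₑ = ENNReal.ofReal (∫ z, |H z|) := by
    rw [← ofReal_integral_norm_eq_lintegral_enorm hH]
    rfl
  rw [h2, ← ENNReal.ofReal_mul hc] at h1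
  have hi : Integrable (fun ω => H (X ω)) μ :=
    ⟨(hHm.comp hX).aestronglyMeasurable, h1.trans_lt ENNReal.ofReal_lt_top⟩
  refine ⟨hi, ?_⟩
  rw [← ofReal_integral_norm_eq_lintegral_enorm hi] at h1
  exact (ENNReal.ofReal_le_ofReal_iff
    (mul_nonneg hc (integral_nonneg fun _ => abs_nonneg _))).1 h1

lemma abs_integral_pair_le {Ω : Type*} {m' m : MeasurableSpace Ω} (hm : m' ≤ m)
    (μ : Measure Ω) [IsProbabilityMeasure μ] {X Z : Ω → ℝ} (hX : Measurable[m'] X)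
    (hZ : Measurable Z) {b : ℝ} (hb : 0 < b) {D : Ω → ℝ → ℝ}
    (hD : ∀ ψ : ℝ → ℝ, Measurable ψ → (∃ C, ∀ y, |ψ y| ≤ C) →
      μ[fun ω => ψ (b⁻¹ * (Z ω - X ω)) | m'] =ᵐ[μ] fun ω => ∫ y, ψ y * D ω y)
    {C : ℝ} (hC0 : 0 ≤ C) (hC : ∀ ω y, D ω y ≤ C) {c : ℝ} (hc : 0 ≤ c)
    (hlaw : ∀ f : ℝ → ENNReal, Measurable f →
      ∫⁻ ω, f (X ω) ∂μ ≤ ENNReal.ofReal c * ∫⁻ z, f z)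
    {A : ℝ → ℝ} (hAm : Measurable A) (hA : Integrable A) :
    Integrable (fun ω => A (X ω) * A (Z ω)) μ ∧
      |∫ ω, A (X ω) * A (Z ω) ∂μ| ≤ c * C / b * (∫ z, |A z|) ^ 2 := by
  have hXm : Measurable X := hX.mono hm le_rfl
  have hI : 0 ≤ ∫ z, |A z| := integral_nonneg fun _ => abs_nonneg _
  have hAe : ∫⁻ z, ‖A z‖ₑ = ENNReal.ofReal (∫ z, |A z|) := by
    rw [← ofReal_integral_norm_eq_lintegral_enorm hA]
    rfl
  have h1 : ∫⁻ ω, ‖A (X ω) * A (Z ω)‖ₑ ∂μ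
      ≤ ENNReal.ofReal (c * C / b * (∫ z, |A z|) ^ 2) := by
    calc ∫⁻ ω, ‖A (X ω) * A (Z ω)‖ₑ ∂μ
        ≤ ENNReal.ofReal (C / b) * ∫⁻ ω, (∫⁻ z, ‖A (X ω) * A z‖ₑ) ∂μ :=
          lintegral_pair_le hm μ hX hZ hb hD hC (f := fun p => ‖A p.1 * A p.2‖ₑ) (by fun_prop)
      _ = ENNReal.ofReal (C / b) * ∫⁻ ω, ‖A (X ω)‖ₑ * ENNReal.ofReal (∫ z, |A z|) ∂μ := by
          congr 2
          ext ω
          simp only [enorm_mul]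
          rw [lintegral_const_mul _ (by fun_prop), hAe]
      _ ≤ ENNReal.ofReal (C / b) * (ENNReal.ofReal c * ENNReal.ofReal (∫ z, |A z|)
            * ENNReal.ofReal (∫ z, |A z|)) := by
          gcongr
          rw [lintegral_mul_const _ (by fun_prop)]
          gcongr
          rw [← hAe]
          exact hlaw (fun z => ‖A z‖ₑ) (by fun_prop)
      _ = ENNReal.ofReal (c * C / b * (∫ z, |A z|) ^ 2) := by
          rw [← ENNReal.ofReal_mul hc, ← ENNReal.ofReal_mul (by positivity),
            ← ENNReal.ofReal_mul (by positivity)]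
          congr 1
          ring
  have hi : Integrable (fun ω => A (X ω) * A (Z ω)) μ :=
    ⟨by fun_prop, h1.trans_lt ENNReal.ofReal_lt_top⟩
  refine ⟨hi, ?_⟩
  rw [← ofReal_integral_norm_eq_lintegral_enorm hi,
    ENNReal.ofReal_le_ofReal_iff (by positivity)] at h1
  exact (norm_integral_le_integral_norm _).trans h1

lemma abs_integral_pair_mean_zero_le {Ω : Type*} {m' m : MeasurableSpace Ω} (hm : m' ≤ m)
    (μ : Measure Ω) [IsProbabilityMeasure μ] {X Z : Ω → ℝ} (hX : Measurable[m'] X)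
    (hZ : Measurable Z) {b : ℝ} (hb : 0 < b) {D : Ω → ℝ → ℝ}
    (hD : ∀ ψ : ℝ → ℝ, Measurable ψ → (∃ C, ∀ y, |ψ y| ≤ C) →
      μ[fun ω => ψ (b⁻¹ * (Z ω - X ω)) | m'] =ᵐ[μ] fun ω => ∫ y, ψ y * D ω y)
    {C : ℝ} (hC0 : 0 ≤ C) (hC : ∀ ω y, D ω y ≤ C) {c : ℝ} (hc : 0 ≤ c)
    (hlaw : ∀ f : ℝ → ENNReal, Measurable f →
      ∫⁻ ω, f (X ω) ∂μ ≤ ENNReal.ofReal c * ∫⁻ z, f z)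
    {A : ℝ → ℝ} (hAm : Measurable A) (hA : Integrable A) (hA0 : ∫ z, A z = 0) {r ρ ε : ℝ}
    (hρ : 0 < ρ) (hrb : 2 * r ≤ ρ * b) (hε : 0 ≤ ε)
    (hosc : ∀ ω y, |y| ≤ ρ → |D ω y - D ω 0| ≤ ε) :
    |∫ ω, A (X ω) * A (Z ω) ∂μ| ≤ c / b * (∫ z, |A z|) *
      (ε * (∫ z, |A z|) + (3 * C + ε) * ∫ z, {z | r < |z|}.indicator (fun z => |A z|) z) := by
  have hXm : Measurable X := hX.mono hm le_rfl
  have hi := (abs_integral_pair_le hm μ hX hZ hb hD hC0 hC hc hlaw hAm hA).1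
  set I := ∫ z, |A z| with hIdef
  set J := ∫ z, {z | r < |z|}.indicator (fun z => |A z|) z with hJdef
  have hms : MeasurableSet {z : ℝ | r < |z|} := measurableSet_lt measurable_const (by fun_prop)
  have hI : 0 ≤ I := integral_nonneg fun _ => abs_nonneg _
  have hJ : 0 ≤ J := integral_nonneg fun z => Set.indicator_nonneg (fun _ _ => abs_nonneg _) z
  let Y : Ω → ℝ := fun ω => b⁻¹ * (Z ω - X ω)
  have hY : Measurable Y := by fun_prop
  have hZY : ∀ ω, X ω + b * Y ω = Z ω := fun ω => by simp [Y, hb.ne']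
  have hid : @Measurable Ω Ω m m' id := measurable_id'' hm
  have hdens := condDistrib_ae_eq_withDensity (mT := m') μ (π := id) hid hY (D := D)
    (by simpa only [MeasurableSpace.comap_id] using hD)
  have hfm : StronglyMeasurable[m'.prod inferInstance]
      fun p : Ω × ℝ => A (X p.1) * A (X p.1 + b * p.2) := by
    have h1 : Measurable[m'.prod inferInstance] fun p : Ω × ℝ => X p.1 :=
      hX.comp (@measurable_fst Ω ℝ m' _)
    have h2 : Measurable[m'.prod inferInstance] fun p : Ω × ℝ => p.2 := @measurable_snd Ω ℝ m' _
    exact ((hAm.comp h1).mul (hAm.comp (h1.add (h2.const_mul b)))).stronglyMeasurable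
  have hcond := condExp_prod_ae_eq_integral_condDistrib (mβ := m') (μ := μ) hid hY.aemeasurable hfm
    (by simpa only [id, hZY] using hi)
  let H : ℝ → ℝ := fun x =>
    b⁻¹ * (ε * I + (2 * C + ε) * J) * |A x|
      + b⁻¹ * C * I * {z : ℝ | r < |z|}.indicator (fun z => |A z|) x
  have hT : Integrable ({z : ℝ | r < |z|}.indicator fun z => |A z|) := hA.abs.indicator hms
  have hHm : Measurable H := by
    have : Measurable ({z : ℝ | r < |z|}.indicator fun z => |A z|) :=
      Measurable.indicator (by fun_prop) hms
    fun_prop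
  have hHi : Integrable H := (hA.abs.const_mul _).add (hT.const_mul _)
  have hHX := integrable_comp_of_law_le hXm hc hlaw hHm hHi
  have hH0 : ∀ x, 0 ≤ H x := fun x => by
    have := Set.indicator_nonneg (s := {z : ℝ | r < |z|}) (fun z _ => abs_nonneg (A z)) x
    positivity
  have hbound : ∀ᵐ ω ∂μ,
      ‖∫ y, A (X ω) * A (X ω + b * y) ∂(@condDistrib Ω Ω ℝ _ _ _ m m' Y id μ _ ω)‖ ≤ H (X ω) := by
    filter_upwards [hdens] with ω ⟨hDi, hD0, hκ⟩
    rw [integral_const_mul, norm_mul, Real.norm_eq_abs]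
    have e1 : ∫ y, A (X ω + b * y) ∂(@condDistrib Ω Ω ℝ _ _ _ m m' Y id μ _ ω)
        = ∫ y, A (X ω + b * y) * D ω y := by
      have : @condDistrib Ω Ω ℝ _ _ _ m m' Y id μ _ ω
        = volume.withDensity fun y => ENNReal.ofReal (D ω y) := hκ
      rw [this, integral_withDensity_eq_integral_toReal_smul₀ hDi.aemeasurable.ennreal_ofReal
        (Eventually.of_forall fun _ => ENNReal.ofReal_lt_top)]
      refine integral_congr_ae ?_
      filter_upwards [hD0] with y hy
      rw [ENNReal.toReal_ofReal hy, smul_eq_mul, mul_comm]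
    rw [e1]
    by_cases hx : r < |X ω|
    · have h2 : ‖∫ y, A (X ω + b * y) * D ω y‖ ≤ b⁻¹ * C * I := by
        calc ‖∫ y, A (X ω + b * y) * D ω y‖ ≤ ∫ y, C * |A (X ω + b * y)| := by
              refine norm_integral_le_of_norm_le ((integrable_affine hA _ hb).abs.const_mul _) ?_
              filter_upwards [hD0] with y hy
              rw [norm_mul, Real.norm_eq_abs, Real.norm_eq_abs, abs_of_nonneg hy, mul_comm]
              exact mul_le_mul_of_nonneg_right (hC ω y) (abs_nonneg _)
          _ = b⁻¹ * C * I := by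
              rw [integral_const_mul, integral_affine (fun z => |A z|) _ hb]
              ring
      have h3 : H (X ω) = b⁻¹ * (ε * I + (2 * C + ε) * J) * |A (X ω)| + b⁻¹ * C * I * |A (X ω)| := by
        simp only [H]
        rw [Set.indicator_of_mem (by exact hx)]
      rw [h3]
      have h4 : 0 ≤ b⁻¹ * (ε * I + (2 * C + ε) * J) * |A (X ω)| := by positivity
      nlinarith [abs_nonneg (A (X ω))]
    · have h2 := abs_integral_mean_zero_le hDi hD0 (hC ω) hA hA0 hb hρ hrb hε (hosc ω)
        (not_lt.1 hx)
      have h3 : H (X ω) = b⁻¹ * (ε * I + (2 * C + ε) * J) * |A (X ω)| := by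
        simp only [H]
        rw [Set.indicator_of_notMem (by exact hx), mul_zero, add_zero]
      rw [h3, Real.norm_eq_abs]
      nlinarith [abs_nonneg (A (X ω))]
  have e2 : ∫ ω, A (X ω) * A (Z ω) ∂μ
      = ∫ ω, (∫ y, A (X ω) * A (X ω + b * y) ∂(@condDistrib Ω Ω ℝ _ _ _ m m' Y id μ _ ω)) ∂μ := by
    have h5 := integral_congr_ae hcond
    rw [integral_condExp (by rw [MeasurableSpace.comap_id]; exact hm)] at h5
    simpa only [id, hZY] using h5
  rw [e2]
  calc _ ≤ ∫ ω, H (X ω) ∂μ := norm_integral_le_of_norm_le hHX.1 hbound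
    _ ≤ ∫ ω, |H (X ω)| ∂μ := integral_mono hHX.1 hHX.1.abs fun _ => le_abs_self _
    _ ≤ c * ∫ z, |H z| := hHX.2
    _ = c * ∫ z, H z := by simp only [abs_of_nonneg (hH0 _)]
    _ = c / b * I * (ε * I + (3 * C + ε) * J) := by
        simp only [H]
        rw [integral_add (hA.abs.const_mul _) (hT.const_mul _), integral_const_mul,
          integral_const_mul, ← hIdef, ← hJdef]
        ring

lemma map_absolutelyContinuous_of_condDensity {Ω : Type*} {m' m : MeasurableSpace Ω} (hm : m' ≤ m)
    (μ : Measure Ω) [IsProbabilityMeasure μ] {Y : Ω → ℝ} (hY : Measurable Y) {D : Ω → ℝ → ℝ}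
    (hD : ∀ ψ : ℝ → ℝ, Measurable ψ → (∃ C, ∀ y, |ψ y| ≤ C) →
      μ[fun ω => ψ (Y ω) | m'] =ᵐ[μ] fun ω => ∫ y, ψ y * D ω y) :
    Measure.map Y μ ≪ volume := by
  refine Measure.AbsolutelyContinuous.mk fun s hs hs0 => ?_
  have h := hD (s.indicator fun _ => 1) (measurable_const.indicator hs)
    ⟨1, fun y => by by_cases hy : y ∈ s <;> simp [hy]⟩
  have h2 := integral_congr_ae h
  rw [integral_condExp hm] at h2
  have e1 : (fun ω => s.indicator (fun _ => (1 : ℝ)) (Y ω))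
      = (Y ⁻¹' s).indicator fun _ => (1 : ℝ) := rfl
  have e2 : ∀ ω, ∫ y, s.indicator (fun _ => (1 : ℝ)) y * D ω y = 0 := fun ω => by
    refine integral_eq_zero_of_ae ?_
    filter_upwards [measure_eq_zero_iff_ae_notMem.1 hs0] with y hy
    simp [hy]
  rw [e1, integral_indicator_const _ (hY hs)] at h2
  simp only [e2, integral_zero, smul_eq_mul, mul_one] at h2
  rw [Measure.map_apply hY hs]
  exact (measureReal_eq_zero_iff (by finiteness)).1 h2

end ConditionalDensity

section SecondMoment

lemma sum_sum_le_near_add_far (t₀ n : ℕ) (e b : ℕ → ℕ → ℝ) (d : ℕ → ℝ)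
    (hsymm : ∀ s t, e s t = e t s) (hd : ∀ s, 0 ≤ d s) (hb : ∀ s u, 0 ≤ b s u)
    (hnear : ∀ s ∈ Icc t₀ n, ∀ t ∈ Icc t₀ n, e s t ≤ (d s + d t) / 2)
    (hfar : ∀ s ∈ Icc t₀ n, ∀ t ∈ Icc t₀ n, s + t₀ ≤ t → e s t ≤ b s (t - s)) :
    ∑ s ∈ Icc t₀ n, ∑ t ∈ Icc t₀ n, e s t
      ≤ 2 * t₀ * ∑ s ∈ Icc t₀ n, d s + 2 * ∑ s ∈ Icc t₀ n, ∑ u ∈ Icc t₀ n, b s u := by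
  set S := Icc t₀ n
  let N : ℕ → ℕ → ℝ := fun s t => if t < s + t₀ ∧ s < t + t₀ then 1 else 0
  let G : ℕ → ℕ → ℝ := fun s t => if s + t₀ ≤ t then b s (t - s) else 0
  have hN0 : ∀ s t, 0 ≤ N s t := fun s t => by simp only [N]; split_ifs <;> norm_num
  have hG0 : ∀ s t, 0 ≤ G s t := fun s t => by
    simp only [G]; split_ifs
    · exact hb _ _
    · exact le_rfl
  have hpt : ∀ s ∈ S, ∀ t ∈ S, e s t ≤ N s t * d s / 2 + N s t * d t / 2 + G s t + G t s := by
    intro s hs t ht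
    have h1 := hG0 s t
    have h2 := hG0 t s
    by_cases hn : t < s + t₀ ∧ s < t + t₀
    · have h3 : N s t = 1 := if_pos hn
      rw [h3]
      linarith [hnear s hs t ht]
    · have h3 : N s t = 0 := if_neg hn
      rw [h3]
      by_cases h4 : s + t₀ ≤ t
      · have : G s t = b s (t - s) := if_pos h4
        linarith [hfar s hs t ht h4]
      · have h5 : t + t₀ ≤ s := by
          by_contra h5
          exact hn ⟨not_le.1 h4, not_le.1 h5⟩
        have : G t s = b t (s - t) := if_pos h5
        linarith [hfar t ht s hs h5, hsymm s t]
  have hNsum : ∀ s, ∑ t ∈ S, N s t ≤ 2 * t₀ := by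
    intro s
    simp only [N]
    rw [sum_boole]
    have h1 : S.filter (fun t => t < s + t₀ ∧ s < t + t₀) ⊆ Ico (s + 1 - t₀) (s + t₀) := by
      intro t ht
      simp only [mem_filter, mem_Ico] at ht ⊢
      omega
    have h2 := card_le_card h1
    rw [Nat.card_Ico] at h2
    have h3 : #(S.filter (fun t => t < s + t₀ ∧ s < t + t₀)) ≤ 2 * t₀ := by omega
    exact_mod_cast h3
  have hNd : ∑ s ∈ S, ∑ t ∈ S, N s t * d s ≤ 2 * t₀ * ∑ s ∈ S, d s := by
    rw [mul_sum]
    refine sum_le_sum fun s _ => ?_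
    rw [← sum_mul]
    exact mul_le_mul_of_nonneg_right (hNsum s) (hd s)
  have hNd' : ∑ s ∈ S, ∑ t ∈ S, N s t * d t ≤ 2 * t₀ * ∑ s ∈ S, d s := by
    rw [sum_comm]
    refine le_trans (le_of_eq ?_) hNd
    refine sum_congr rfl fun s _ => sum_congr rfl fun t _ => ?_
    simp only [N, and_comm]
  have hGs : ∑ s ∈ S, ∑ t ∈ S, G s t ≤ ∑ s ∈ S, ∑ u ∈ S, b s u := by
    refine sum_le_sum fun s _ => ?_
    simp only [G]
    rw [← sum_filter]
    have hinj : Set.InjOn (fun t => t - s) (S.filter fun t => s + t₀ ≤ t : Finset ℕ) := by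
      intro x hx y hy hxy
      simp only [coe_filter, Set.mem_ofPred_eq] at hx hy hxy
      omega
    rw [← sum_image (f := fun u => b s u) hinj]
    refine sum_le_sum_of_subset_of_nonneg ?_ fun u _ _ => hb s u
    intro u hu
    simp only [mem_image, mem_filter, S, mem_Icc] at hu ⊢
    omega
  have hGs' : ∑ s ∈ S, ∑ t ∈ S, G t s ≤ ∑ s ∈ S, ∑ u ∈ S, b s u := by
    rw [sum_comm]
    exact hGs
  calc ∑ s ∈ S, ∑ t ∈ S, e s t
      ≤ ∑ s ∈ S, ∑ t ∈ S, (N s t * d s / 2 + N s t * d t / 2 + G s t + G t s) :=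
        sum_le_sum fun s hs => sum_le_sum fun t ht => hpt s hs t ht
    _ = (∑ s ∈ S, ∑ t ∈ S, N s t * d s) / 2 + (∑ s ∈ S, ∑ t ∈ S, N s t * d t) / 2
        + ∑ s ∈ S, ∑ t ∈ S, G s t + ∑ s ∈ S, ∑ t ∈ S, G t s := by
        simp only [sum_add_distrib, sum_div]
    _ ≤ _ := by linarith

/-- Non-asymptotic bound on the second moment of an additive functional of a mean-zero function. -/
lemma integral_sq_sum_le {Ω : Type*} [m : MeasurableSpace Ω] (μ : Measure Ω)
    [IsProbabilityMeasure μ] (F : ℤ → MeasurableSpace Ω) (hFle : ∀ i, F i ≤ m)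
    (X : ℕ → Ω → ℝ) (hXadapted : ∀ t : ℕ, Measurable[F (t : ℤ)] (X t))
    (β : ℕ → ℝ) (hβpos : ∀ n, 0 < β n) (n t₀ : ℕ) (ht₀ : 1 ≤ t₀) (D : ℕ → ℕ → Ω → ℝ → ℝ)
    (hD : ∀ t s : ℕ, s < t → t ≤ n →
      ∀ ψ : ℝ → ℝ, Measurable ψ → (∃ C, ∀ y, |ψ y| ≤ C) →
        μ[fun ω => ψ ((β (t - s))⁻¹ * (X t ω - X s ω)) | F (s : ℤ)]
          =ᵐ[μ] fun ω => ∫ y, ψ y * D t s ω y)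
    {C : ℝ} (hC0 : 0 ≤ C)
    (hC : ∀ t s : ℕ, s < t → t ≤ n → t₀ ≤ t - s → ∀ ω y, D t s ω y ≤ C)
    {A : ℝ → ℝ} (hAm : Measurable A) (hA : Integrable A) (hA2 : Integrable fun z => A z ^ 2)
    (hA0 : ∫ z, A z = 0) {r ρ ε : ℝ} (hρ : 0 < ρ) (hε : 0 ≤ ε) (p q : ℕ)
    (hrb : ∀ s t : ℕ, t₀ ≤ s → t₀ ≤ t - s → p ≤ s → s ≤ q → p + s ≤ t → t ≤ n →
      2 * r ≤ ρ * β (t - s))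
    (hosc : ∀ s t : ℕ, p ≤ s → s ≤ q → p + s ≤ t → t ≤ n →
      ∀ ω y, |y| ≤ ρ → |D t s ω y - D t s ω 0| ≤ ε) :
    (Integrable (fun ω => (∑ t ∈ Icc t₀ n, A (X t ω)) ^ 2) μ) ∧
    ∫ ω, (∑ t ∈ Icc t₀ n, A (X t ω)) ^ 2 ∂μ ≤
      2 * t₀ * C * (∫ z, A z ^ 2) * (∑ t ∈ Icc t₀ n, (β t)⁻¹) +
      2 * (C ^ 2 * (∫ z, |A z|) ^ 2 * (∑ t ∈ Icc t₀ n, (β t)⁻¹) *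
            (2 * (∑ t ∈ Icc t₀ p, (β t)⁻¹) + ∑ t ∈ Icc q n, (β t)⁻¹) +
          C * (∫ z, |A z|) * (ε * (∫ z, |A z|)
            + (3 * C + ε) * ∫ z, {z | r < |z|}.indicator (fun z => |A z|) z)
            * (∑ t ∈ Icc t₀ n, (β t)⁻¹) ^ 2) := by
  have hXm : ∀ t, Measurable (X t) := fun t => (hXadapted t).mono (hFle _) le_rfl
  set I := ∫ z, |A z| with hIdef
  set J := ∫ z, {z | r < |z|}.indicator (fun z => |A z|) z with hJdef
  have hI : 0 ≤ I := integral_nonneg fun _ => abs_nonneg _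
  have hJ : 0 ≤ J := integral_nonneg fun z => Set.indicator_nonneg (fun _ _ => abs_nonneg _) z
  have hA2n : 0 ≤ ∫ z, A z ^ 2 := integral_nonneg fun _ => sq_nonneg _
  have hlaw : ∀ s ∈ Icc t₀ n, ∀ f : ℝ → ENNReal, Measurable f →
      ∫⁻ ω, f (X s ω) ∂μ ≤ ENNReal.ofReal (C / β s) * ∫⁻ z, f z := by
    intro s hs f hf
    obtain ⟨h1, h2⟩ := mem_Icc.1 hs
    have h3 := lintegral_pair_le (hFle ((0 : ℕ) : ℤ)) μ (hXadapted 0) (hXm s) (hβpos (s - 0))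
      (hD s 0 (by omega) h2) (hC s 0 (by omega) h2 (by omega)) (f := fun p => f p.2) (by fun_prop)
    simpa using h3
  have hsq : ∀ s ∈ Icc t₀ n, Integrable (fun ω => A (X s ω) ^ 2) μ ∧
      ∫ ω, A (X s ω) ^ 2 ∂μ ≤ C / β s * ∫ z, A z ^ 2 := by
    intro s hs
    have h := integrable_comp_of_law_le (hXm s) (div_nonneg hC0 (hβpos s).le) (hlaw s hs)
      (H := fun z => A z ^ 2) (by fun_prop) hA2
    simpa only [abs_pow, sq_abs] using h
  have hint : ∀ s ∈ Icc t₀ n, ∀ t ∈ Icc t₀ n, Integrable (fun ω => A (X s ω) * A (X t ω)) μ := by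
    intro s hs t ht
    have hL : ∀ s ∈ Icc t₀ n, MemLp (fun ω => A (X s ω)) 2 μ := fun s hs =>
      (memLp_two_iff_integrable_sq (hAm.comp (hXm s)).aestronglyMeasurable).2 (hsq s hs).1
    exact (hL s hs).integrable_mul (hL t ht)
  let e : ℕ → ℕ → ℝ := fun s t => |∫ ω, A (X s ω) * A (X t ω) ∂μ|
  let χ : Prop → ℝ := fun P => Set.indicator {_x : Unit | P} (fun _ => (1 : ℝ)) ()
  have hχ0 : ∀ P, 0 ≤ χ P := fun P => Set.indicator_nonneg (fun _ _ => zero_le_one) _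
  have hχ1 : ∀ P : Prop, P → χ P = 1 := fun P hP => Set.indicator_of_mem (by exact hP) _
  let c₁ := C ^ 2 * I ^ 2
  let c₂ := C * I * (ε * I + (3 * C + ε) * J)
  have hc₁ : 0 ≤ c₁ := by positivity
  have hc₂ : 0 ≤ c₂ := by positivity
  let b : ℕ → ℕ → ℝ := fun s u => (β s)⁻¹ * (β u)⁻¹ *
    (c₁ * (χ (s ≤ p) + χ (q ≤ s) + χ (u ≤ p)) + c₂)
  have hβi : ∀ s, 0 ≤ (β s)⁻¹ := fun s => (inv_pos.2 (hβpos s)).le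
  have hb0 : ∀ s u, 0 ≤ b s u := fun s u => by
    have h1 := hχ0 (s ≤ p)
    have h2 := hχ0 (q ≤ s)
    have h3 := hχ0 (u ≤ p)
    have h4 := hβi s
    have h5 := hβi u
    positivity
  have hfar : ∀ s ∈ Icc t₀ n, ∀ t ∈ Icc t₀ n, s + t₀ ≤ t → e s t ≤ b s (t - s) := by
    intro s hs t ht hst
    obtain ⟨hs1, hs2⟩ := mem_Icc.1 hs
    obtain ⟨ht1, ht2⟩ := mem_Icc.1 ht
    have hlt : s < t := by omega
    have hge : t₀ ≤ t - s := by omega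
    have hw : 0 ≤ (β s)⁻¹ * (β (t - s))⁻¹ := mul_nonneg (hβi _) (hβi _)
    by_cases hΩ : p ≤ s ∧ s ≤ q ∧ p + s ≤ t
    · have h1 := abs_integral_pair_mean_zero_le (hFle s) μ (hXadapted s) (hXm t) (hβpos (t - s))
        (hD t s hlt ht2) hC0 (hC t s hlt ht2 hge) (div_nonneg hC0 (hβpos s).le) (hlaw s hs)
        hAm hA hA0 hρ (hrb s t hs1 hge hΩ.1 hΩ.2.1 hΩ.2.2 ht2) hε
        (hosc s t hΩ.1 hΩ.2.1 hΩ.2.2 ht2)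
      calc e s t ≤ _ := h1
        _ = (β s)⁻¹ * (β (t - s))⁻¹ * c₂ := by
          simp only [c₂, ← hIdef, ← hJdef, div_eq_mul_inv]
          ring
        _ ≤ b s (t - s) := by
          refine mul_le_mul_of_nonneg_left ?_ hw
          have h2 := hχ0 (s ≤ p)
          have h3 := hχ0 (q ≤ s)
          have h4 := hχ0 (t - s ≤ p)
          have : 0 ≤ c₁ * (χ (s ≤ p) + χ (q ≤ s) + χ (t - s ≤ p)) := by positivity
          linarith
    · have h1 := (abs_integral_pair_le (hFle s) μ (hXadapted s) (hXm t) (hβpos (t - s))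
        (hD t s hlt ht2) hC0 (hC t s hlt ht2 hge) (div_nonneg hC0 (hβpos s).le) (hlaw s hs)
        hAm hA).2
      calc e s t ≤ _ := h1
        _ = (β s)⁻¹ * (β (t - s))⁻¹ * c₁ := by
          simp only [c₁, ← hIdef, div_eq_mul_inv]
          ring
        _ ≤ b s (t - s) := by
          refine mul_le_mul_of_nonneg_left ?_ hw
          have h2 := hχ0 (s ≤ p)
          have h3 := hχ0 (q ≤ s)
          have h4 := hχ0 (t - s ≤ p)
          have h5 : 1 ≤ χ (s ≤ p) + χ (q ≤ s) + χ (t - s ≤ p) := by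
            by_cases h6 : s ≤ p
            · linarith [hχ1 _ h6]
            by_cases h7 : q ≤ s
            · linarith [hχ1 _ h7]
            · have h8 : t - s ≤ p := by omega
              linarith [hχ1 _ h8]
          nlinarith
  have hmain := sum_sum_le_near_add_far t₀ n e b (fun s => C / β s * ∫ z, A z ^ 2)
    (fun s t => by simp only [e, mul_comm])
    (fun s => mul_nonneg (div_nonneg hC0 (hβpos s).le) hA2n) hb0
    (fun s hs t ht => by
      calc e s t ≤ ∫ ω, |A (X s ω) * A (X t ω)| ∂μ := abs_integral_le_integral_abs
        _ ≤ ∫ ω, (A (X s ω) ^ 2 + A (X t ω) ^ 2) / 2 ∂μ := by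
            refine integral_mono (hint s hs t ht).abs (((hsq s hs).1.add (hsq t ht).1).div_const _)
              fun ω => ?_
            simp only [abs_mul]
            rw [← sq_abs (A (X s ω)), ← sq_abs (A (X t ω))]
            nlinarith [sq_nonneg (|A (X s ω)| - |A (X t ω)|)]
        _ = (∫ ω, A (X s ω) ^ 2 ∂μ + ∫ ω, A (X t ω) ^ 2 ∂μ) / 2 := by
            rw [integral_div, integral_add (hsq s hs).1 (hsq t ht).1]
        _ ≤ _ := by linarith [(hsq s hs).2, (hsq t ht).2])
    hfar
  have hexp : ∀ ω, (∑ t ∈ Icc t₀ n, A (X t ω)) ^ 2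
      = ∑ s ∈ Icc t₀ n, ∑ t ∈ Icc t₀ n, A (X s ω) * A (X t ω) := fun ω => by
    rw [sq, sum_mul_sum]
  have hχsum : ∀ P : ℕ → Prop, ∀ T : Finset ℕ, (∀ s ∈ Icc t₀ n, P s → s ∈ T) →
      ∑ s ∈ Icc t₀ n, (β s)⁻¹ * χ (P s) ≤ ∑ s ∈ T, (β s)⁻¹ := by
    classical
    intro P T hPT
    have h1 : ∀ s, (β s)⁻¹ * χ (P s) = if P s then (β s)⁻¹ else 0 := by
      intro s
      by_cases hP : P s <;> simp [χ, hP]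
    simp only [h1]
    rw [← sum_filter]
    exact sum_le_sum_of_subset_of_nonneg (fun s hs => hPT s (mem_filter.1 hs).1 (mem_filter.1 hs).2)
      fun s _ _ => hβi s
  have hB1 : ∑ s ∈ Icc t₀ n, (β s)⁻¹ * χ (s ≤ p) ≤ ∑ t ∈ Icc t₀ p, (β t)⁻¹ :=
    hχsum (fun s => s ≤ p) _ fun s hs hP => mem_Icc.2 ⟨(mem_Icc.1 hs).1, hP⟩
  have hB2 : ∑ s ∈ Icc t₀ n, (β s)⁻¹ * χ (q ≤ s) ≤ ∑ t ∈ Icc q n, (β t)⁻¹ :=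
    hχsum (fun s => q ≤ s) _ fun s hs hP => mem_Icc.2 ⟨hP, (mem_Icc.1 hs).2⟩
  set V := ∑ t ∈ Icc t₀ n, (β t)⁻¹ with hV
  have hV0 : 0 ≤ V := sum_nonneg fun s _ => hβi s
  have hbsum : ∑ s ∈ Icc t₀ n, ∑ u ∈ Icc t₀ n, b s u
      = c₁ * ((∑ s ∈ Icc t₀ n, (β s)⁻¹ * χ (s ≤ p)) * V
        + (∑ s ∈ Icc t₀ n, (β s)⁻¹ * χ (q ≤ s)) * V
        + V * ∑ s ∈ Icc t₀ n, (β s)⁻¹ * χ (s ≤ p)) + c₂ * V ^ 2 := by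
    rw [hV, sq]
    simp only [sum_mul_sum]
    simp only [mul_sum, mul_add, ← sum_add_distrib, b]
    refine sum_congr rfl fun s _ => sum_congr rfl fun u _ => ?_
    ring
  have hdsum : ∑ s ∈ Icc t₀ n, C / β s * ∫ z, A z ^ 2 = C * (∫ z, A z ^ 2) * V := by
    rw [hV, mul_sum]
    refine sum_congr rfl fun s _ => ?_
    rw [div_eq_mul_inv]
    ring
  refine ⟨?_, ?_⟩
  · simp only [hexp]
    exact integrable_finsetSum _ fun s hs => integrable_finsetSum _ fun t ht => hint s hs t ht
  · simp only [hexp]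
    rw [integral_finsetSum _ fun s hs => integrable_finsetSum _ fun t ht => hint s hs t ht]
    calc ∑ s ∈ Icc t₀ n, ∫ ω, ∑ t ∈ Icc t₀ n, A (X s ω) * A (X t ω) ∂μ
        = ∑ s ∈ Icc t₀ n, ∑ t ∈ Icc t₀ n, ∫ ω, A (X s ω) * A (X t ω) ∂μ :=
          sum_congr rfl fun s hs => integral_finsetSum _ fun t ht => hint s hs t ht
      _ ≤ ∑ s ∈ Icc t₀ n, ∑ t ∈ Icc t₀ n, e s t :=
          sum_le_sum fun s _ => sum_le_sum fun t _ => le_abs_self _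
      _ ≤ _ := hmain
      _ ≤ _ := by
          rw [hbsum, hdsum]
          have h1 : c₁ * ((∑ s ∈ Icc t₀ n, (β s)⁻¹ * χ (s ≤ p)) * V
            + (∑ s ∈ Icc t₀ n, (β s)⁻¹ * χ (q ≤ s)) * V
            + V * ∑ s ∈ Icc t₀ n, (β s)⁻¹ * χ (s ≤ p))
            ≤ c₁ * (V * (2 * (∑ t ∈ Icc t₀ p, (β t)⁻¹) + ∑ t ∈ Icc q n, (β t)⁻¹)) := by
            refine mul_le_mul_of_nonneg_left ?_ hc₁
            nlinarith
          simp only [c₁, c₂] at h1 ⊢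
          nlinarith

end SecondMoment

section KernelContrast

/-- The difference between a kernel rescaled at bandwidth `c` and its smoothing by a bump at
scale `b`. -/
noncomputable def kernelContrast (K f : ℝ → ℝ) (x b c z : ℝ) : ℝ :=
  b / c * K ((z - x) / c) - (∫ u, K u) * f (z / b)

variable {K f : ℝ → ℝ} {x b c : ℝ}

lemma integral_comp_sub_div (G : ℝ → ℝ) (x : ℝ) {c : ℝ} (hc : 0 < c) :
    ∫ z, G ((z - x) / c) = c * ∫ u, G u := by
  have h := integral_affine G (-x / c) (inv_pos.2 hc)
  rw [inv_inv] at h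
  rw [← h]
  congr with z
  congr 1
  field_simp
  ring

lemma integrable_comp_sub_div {G : ℝ → ℝ} (hG : Integrable G) (x : ℝ) {c : ℝ} (hc : 0 < c) :
    Integrable fun z => G ((z - x) / c) := by
  have h := integrable_affine hG (-x / c) (inv_pos.2 hc)
  convert h using 3
  field_simp
  ring

lemma integral_comp_div_pos (G : ℝ → ℝ) {c : ℝ} (hc : 0 < c) :
    ∫ z, G (z / c) = c * ∫ u, G u := by
  simpa only [sub_zero] using integral_comp_sub_div G 0 hc

lemma integrable_comp_div_pos {G : ℝ → ℝ} (hG : Integrable G) {c : ℝ} (hc : 0 < c) :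
    Integrable fun z => G (z / c) := by
  simpa only [sub_zero] using integrable_comp_sub_div hG 0 hc

lemma measurable_kernelContrast (hK : Measurable K) (hf : Measurable f) :
    Measurable (kernelContrast K f x b c) := by
  unfold kernelContrast
  fun_prop

lemma integrable_kernelContrast (hK : Integrable K) (hf : Integrable f) (hb : 0 < b) (hc : 0 < c) :
    Integrable (kernelContrast K f x b c) :=
  ((integrable_comp_sub_div hK x hc).const_mul _).sub ((integrable_comp_div_pos hf hb).const_mul _)

lemma integral_kernelContrast (hK : Integrable K) (hf : Integrable f) (hf1 : ∫ y, f y = 1)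
    (hb : 0 < b) (hc : 0 < c) : ∫ z, kernelContrast K f x b c z = 0 := by
  unfold kernelContrast
  rw [integral_sub ((integrable_comp_sub_div hK x hc).const_mul _)
    ((integrable_comp_div_pos hf hb).const_mul _), integral_const_mul, integral_const_mul,
    integral_comp_sub_div K x hc, integral_comp_div_pos f hb, hf1]
  field_simp
  ring

lemma integral_abs_kernelContrast_le (hK : Integrable K) (hf : Integrable f) (hf0 : ∀ y, 0 ≤ f y)
    (hf1 : ∫ y, f y = 1) (hb : 0 < b) (hc : 0 < c) :
    ∫ z, |kernelContrast K f x b c z| ≤ 2 * (∫ u, |K u|) * b := by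
  have i1 := (integrable_comp_sub_div hK.abs x hc).const_mul (b / c)
  have i2 := (integrable_comp_div_pos hf hb).const_mul |∫ u, K u|
  calc ∫ z, |kernelContrast K f x b c z|
      ≤ ∫ z, (b / c * |K ((z - x) / c)| + |∫ u, K u| * f (z / b)) := by
        refine integral_mono (integrable_kernelContrast hK hf hb hc).abs (i1.add i2) fun z => ?_
        refine (abs_sub _ _).trans (le_of_eq ?_)
        rw [abs_mul, abs_mul, abs_of_pos (div_pos hb hc), abs_of_nonneg (hf0 _)]
    _ = b * (∫ u, |K u|) + |∫ u, K u| * b := by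
        rw [integral_add i1 i2, integral_const_mul, integral_const_mul,
          integral_comp_sub_div (fun u => |K u|) x hc, integral_comp_div_pos f hb, hf1]
        field_simp
    _ ≤ _ := by
        have h : |∫ u, K u| ≤ ∫ u, |K u| := abs_integral_le_integral_abs
        nlinarith

lemma kernelContrast_sq_le (hf0 : ∀ y, 0 ≤ f y) {M : ℝ} (hfM : ∀ y, f y ≤ M) (z : ℝ) :
    kernelContrast K f x b c z ^ 2 ≤
      2 * (b / c) ^ 2 * K ((z - x) / c) ^ 2 + 2 * (∫ u, K u) ^ 2 * M * f (z / b) := by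
  unfold kernelContrast
  have h1 := hf0 (z / b)
  have h2 : (∫ u, K u) ^ 2 * f (z / b) ^ 2 ≤ (∫ u, K u) ^ 2 * (M * f (z / b)) :=
    mul_le_mul_of_nonneg_left (by nlinarith [hfM (z / b)]) (sq_nonneg _)
  nlinarith [sq_nonneg (b / c * K ((z - x) / c) + (∫ u, K u) * f (z / b))]

lemma integrable_kernelContrast_sq (hKm : Measurable K) (hfm : Measurable f)
    (hK2 : Integrable fun u => K u ^ 2)
    (hf : Integrable f) (hf0 : ∀ y, 0 ≤ f y) {M : ℝ} (hfM : ∀ y, f y ≤ M) (hb : 0 < b)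
    (hc : 0 < c) : Integrable fun z => kernelContrast K f x b c z ^ 2 := by
  refine (((integrable_comp_sub_div hK2 x hc).const_mul (2 * (b / c) ^ 2)).add
    ((integrable_comp_div_pos hf hb).const_mul (2 * (∫ u, K u) ^ 2 * M))).mono'
    ((measurable_kernelContrast hKm hfm).pow_const 2).aestronglyMeasurable
    (Eventually.of_forall fun z => ?_)
  rw [Real.norm_eq_abs, abs_of_nonneg (sq_nonneg _)]
  exact kernelContrast_sq_le hf0 hfM z

lemma integral_kernelContrast_sq_le (hKm : Measurable K) (hfm : Measurable f)
    (hK2 : Integrable fun u => K u ^ 2)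
    (hf : Integrable f) (hf0 : ∀ y, 0 ≤ f y) (hf1 : ∫ y, f y = 1) {M : ℝ} (hfM : ∀ y, f y ≤ M)
    (hb : 0 < b) (hc : 0 < c) :
    ∫ z, kernelContrast K f x b c z ^ 2 ≤
      2 * (b ^ 2 / c * (∫ u, K u ^ 2) + (∫ u, K u) ^ 2 * M * b) := by
  have i1 := (integrable_comp_sub_div hK2 x hc).const_mul (2 * (b / c) ^ 2)
  have i2 := (integrable_comp_div_pos hf hb).const_mul (2 * (∫ u, K u) ^ 2 * M)
  refine (integral_mono (integrable_kernelContrast_sq hKm hfm hK2 hf hf0 hfM hb hc) (i1.add i2)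
    (kernelContrast_sq_le hf0 hfM)).trans (le_of_eq ?_)
  simp only [Pi.add_apply]
  rw [integral_add i1 i2, integral_const_mul, integral_const_mul,
    integral_comp_sub_div (fun u => K u ^ 2) x hc, integral_comp_div_pos f hb, hf1]
  field_simp

lemma integral_kernelContrast_tail {ε : ℝ} (hfε : ∀ y, ε < |y| → f y = 0) (hb : 0 < b)
    (hc : 0 < c) :
    ∫ z, {z | ε * b < |z|}.indicator (fun z => |kernelContrast K f x b c z|) z =
      b * ∫ u, {u | ε * b < |x + c * u|}.indicator (fun u => |K u|) u := by
  have h : ∀ z, {z | ε * b < |z|}.indicator (fun z => |kernelContrast K f x b c z|) z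
      = b / c * {u | ε * b < |x + c * u|}.indicator (fun u => |K u|) ((z - x) / c) := by
    intro z
    have hz : x + c * ((z - x) / c) = z := by field_simp; ring
    by_cases hzε : ε * b < |z|
    · rw [Set.indicator_of_mem (by exact hzε),
        Set.indicator_of_mem (by rw [Set.mem_ofPred_eq, hz]; exact hzε), kernelContrast,
        hfε _ (by rwa [abs_div, abs_of_pos hb, lt_div_iff₀ hb]), mul_zero, sub_zero, abs_mul,
        abs_of_pos (div_pos hb hc)]
    · rw [Set.indicator_of_notMem (by exact hzε),
        Set.indicator_of_notMem (by rw [Set.mem_ofPred_eq, hz]; exact hzε), mul_zero]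
  rw [integral_congr_ae (Eventually.of_forall h), integral_const_mul,
    integral_comp_sub_div ({u | ε * b < |x + c * u|}.indicator fun u => |K u|) x hc]
  field_simp

lemma tendsto_integral_kernel_tail (hKm : Measurable K) (hK : Integrable K) {β h : ℕ → ℝ}
    (hβpos : ∀ n, 0 < β n) (hβ : Tendsto β atTop atTop)
    (hh : Tendsto (fun n => (β n)⁻¹ * h n) atTop (𝓝 0)) (x : ℝ) {ε : ℝ} (hε : 0 < ε) :
    Tendsto (fun n => ∫ u, {u | ε * β n < |x + h n * u|}.indicator (fun u => |K u|) u) atTop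
      (𝓝 0) := by
  have key : Tendsto (fun n => ∫ u, {u | ε * β n < |x + h n * u|}.indicator (fun u => |K u|) u)
      atTop (𝓝 (∫ _ : ℝ, (0 : ℝ))) := by
    refine tendsto_integral_of_dominated_convergence (fun u => |K u|) (fun n => ?_) hK.abs
      (fun n => Eventually.of_forall fun u => ?_) (Eventually.of_forall fun u => ?_)
    · refine (hKm.abs.indicator ?_).aestronglyMeasurable
      exact measurableSet_lt measurable_const (by fun_prop)
    · exact (norm_indicator_le_norm_self _ u).trans (by simp)
    · have h1 : Tendsto (fun n => |x * (β n)⁻¹ + (β n)⁻¹ * h n * u|) atTop (𝓝 0) := by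
        have := ((hβ.inv_tendsto_atTop.const_mul x).add (hh.mul_const u)).abs
        simpa using this
      refine tendsto_const_nhds.congr' ?_
      filter_upwards [h1.eventually_lt_const hε] with n hn
      rw [Set.indicator_of_notMem]
      rw [Set.mem_ofPred_eq, not_lt]
      have h2 : x + h n * u = (x * (β n)⁻¹ + (β n)⁻¹ * h n * u) * β n := by
        have := (hβpos n).ne'
        field_simp
      rw [h2, abs_mul, abs_of_pos (hβpos n)]
      exact mul_le_mul_of_nonneg_right hn.le (hβpos n).le
  simpa using key

end KernelContrast

section AsymptoticSecondMoment

lemma integral_sq_kernel_average_le {Ω : Type*} [m : MeasurableSpace Ω] (μ : Measure Ω)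
    [IsProbabilityMeasure μ] (F : ℤ → MeasurableSpace Ω) (hFle : ∀ i, F i ≤ m)
    (X : ℕ → Ω → ℝ) (hXadapted : ∀ t : ℕ, Measurable[F (t : ℤ)] (X t))
    (β : ℕ → ℝ) (hβpos : ∀ n, 0 < β n) (n t₀ : ℕ) (ht₀ : 1 ≤ t₀) (hn : 1 ≤ n)
    (D : ℕ → ℕ → Ω → ℝ → ℝ)
    (hD : ∀ t s : ℕ, s < t → t ≤ n →
      ∀ ψ : ℝ → ℝ, Measurable ψ → (∃ C, ∀ y, |ψ y| ≤ C) →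
        μ[fun ω => ψ ((β (t - s))⁻¹ * (X t ω - X s ω)) | F (s : ℤ)]
          =ᵐ[μ] fun ω => ∫ y, ψ y * D t s ω y)
    {C : ℝ} (hC0 : 0 ≤ C)
    (hC : ∀ t s : ℕ, s < t → t ≤ n → t₀ ≤ t - s → ∀ ω y, D t s ω y ≤ C)
    {K f : ℝ → ℝ} (hKm : Measurable K) (hK : Integrable K) (hK2 : Integrable fun u => K u ^ 2)
    (hfm : Measurable f) (hf : Integrable f) (hf0 : ∀ y, 0 ≤ f y) (hf1 : ∫ y, f y = 1)
    {M : ℝ} (hfM : ∀ y, f y ≤ M) {ε : ℝ} (hfε : ∀ y, ε < |y| → f y = 0)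
    {c x : ℝ} (hc : 0 < c) {ρ e : ℝ} (hρ : 0 < ρ) (he : 0 ≤ e) (he1 : e ≤ 1) (p q : ℕ)
    (hrb : ∀ s t : ℕ, t₀ ≤ s → t₀ ≤ t - s → p ≤ s → s ≤ q → p + s ≤ t → t ≤ n →
      2 * (ε * β n) ≤ ρ * β (t - s))
    (hosc : ∀ s t : ℕ, p ≤ s → s ≤ q → p + s ≤ t → t ≤ n →
      ∀ ω y, |y| ≤ ρ → |D t s ω y - D t s ω 0| ≤ e)
    {w : ℝ} (hw : β n / n * ∑ t ∈ Icc t₀ n, (β t)⁻¹ ≤ w)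
    (hp : β n / n * ∑ t ∈ Icc t₀ p, (β t)⁻¹ ≤ e) (hq : β n / n * ∑ t ∈ Icc q n, (β t)⁻¹ ≤ e) :
    (Integrable (fun ω => ((n : ℝ)⁻¹ * ∑ t ∈ Icc t₀ n, kernelContrast K f x (β n) c (X t ω)) ^ 2)
      μ) ∧
    ∫ ω, ((n : ℝ)⁻¹ * ∑ t ∈ Icc t₀ n, kernelContrast K f x (β n) c (X t ω)) ^ 2 ∂μ ≤
      (24 * C ^ 2 * (∫ u, |K u|) ^ 2 * w + 8 * C * (∫ u, |K u|) ^ 2 * w ^ 2) * e +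
      (4 * t₀ * C * w * (β n * (n * c)⁻¹ * (∫ u, K u ^ 2) + (∫ u, K u) ^ 2 * M * (n : ℝ)⁻¹) +
        4 * C * (∫ u, |K u|) * w ^ 2 * (3 * C + 1) *
          ∫ u, {u | ε * β n < |x + c * u|}.indicator (fun u => |K u|) u) := by
  have hb := hβpos n
  have hn0 : (0 : ℝ) < n := by exact_mod_cast hn
  obtain ⟨h1, h2⟩ := integral_sq_sum_le μ F hFle X hXadapted β hβpos n t₀ ht₀ D hD hC0 hC
    (measurable_kernelContrast (x := x) (b := β n) (c := c) hKm hfm)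
    (integrable_kernelContrast hK hf hb hc)
    (integrable_kernelContrast_sq hKm hfm hK2 hf hf0 hfM hb hc)
    (integral_kernelContrast hK hf hf1 hb hc) hρ he p q hrb hosc
  simp only [mul_pow]
  refine ⟨h1.const_mul _, ?_⟩
  rw [integral_const_mul]
  rw [integral_kernelContrast_tail hfε hb hc] at h2
  have a1 := integral_abs_kernelContrast_le (x := x) hK hf hf0 hf1 hb hc
  have a2 := integral_kernelContrast_sq_le (x := x) hKm hfm hK2 hf hf0 hf1 hfM hb hc
  have a0 : 0 ≤ ∫ z, |kernelContrast K f x (β n) c z| := integral_nonneg fun _ => abs_nonneg _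
  set I1 := ∫ z, |kernelContrast K f x (β n) c z|
  set I2 := ∫ z, kernelContrast K f x (β n) c z ^ 2
  set N := ∫ u, |K u|
  set K2 := ∫ u, K u ^ 2
  set κ := ∫ u, K u
  have hτ : 0 ≤ ∫ u, {u | ε * β n < |x + c * u|}.indicator (fun u => |K u|) u :=
    integral_nonneg fun u => Set.indicator_nonneg (fun _ _ => abs_nonneg _) _
  set τ := ∫ u, {u | ε * β n < |x + c * u|}.indicator (fun u => |K u|) u
  have hN : 0 ≤ N := integral_nonneg fun _ => abs_nonneg _
  have hK20 : 0 ≤ K2 := integral_nonneg fun _ => sq_nonneg _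
  have hM : 0 ≤ M := (hf0 0).trans (hfM 0)
  have hV0 : 0 ≤ ∑ t ∈ Icc t₀ n, (β t)⁻¹ := sum_nonneg fun t _ => (inv_pos.2 (hβpos t)).le
  have hP0 : 0 ≤ ∑ t ∈ Icc t₀ p, (β t)⁻¹ := sum_nonneg fun t _ => (inv_pos.2 (hβpos t)).le
  have hQ0 : 0 ≤ ∑ t ∈ Icc q n, (β t)⁻¹ := sum_nonneg fun t _ => (inv_pos.2 (hβpos t)).le
  set V := ∑ t ∈ Icc t₀ n, (β t)⁻¹
  set P := ∑ t ∈ Icc t₀ p, (β t)⁻¹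
  set Q := ∑ t ∈ Icc q n, (β t)⁻¹
  have hW0 : 0 ≤ β n / n * V := by positivity
  calc ((n : ℝ)⁻¹) ^ 2 * ∫ ω, (∑ t ∈ Icc t₀ n, kernelContrast K f x (β n) c (X t ω)) ^ 2 ∂μ
      ≤ ((n : ℝ)⁻¹) ^ 2 * (2 * t₀ * C * (2 * (β n ^ 2 / c * K2 + κ ^ 2 * M * β n)) * V +
        2 * (C ^ 2 * (2 * N * β n) ^ 2 * V * (2 * P + Q) +
          C * (2 * N * β n) * (e * (2 * N * β n) + (3 * C + 1) * (β n * τ)) * V ^ 2)) := by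
        refine mul_le_mul_of_nonneg_left (h2.trans ?_) (by positivity)
        gcongr
    _ = 4 * t₀ * C * (β n / n * V) * (β n * (n * c)⁻¹ * K2 + κ ^ 2 * M * (n : ℝ)⁻¹)
        + 8 * C ^ 2 * N ^ 2 * (β n / n * V) * (2 * (β n / n * P) + β n / n * Q)
        + 4 * C * N * (2 * N * e + (3 * C + 1) * τ) * (β n / n * V) ^ 2 := by
        field_simp
        ring
    _ ≤ 4 * t₀ * C * w * (β n * (n * c)⁻¹ * K2 + κ ^ 2 * M * (n : ℝ)⁻¹)
        + 8 * C ^ 2 * N ^ 2 * w * (2 * e + e)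
        + 4 * C * N * (2 * N * e + (3 * C + 1) * τ) * w ^ 2 := by
        gcongr
        exact mul_nonneg (by positivity) (hW0.trans hw)
    _ = _ := by ring

/-- Kernel averages and bump averages at a small fixed scale are asymptotically close in `L²`. -/
lemma exists_scale_integral_sq_kernel_average_le
    {Ω : Type*} [m : MeasurableSpace Ω] (μ : Measure Ω) [IsProbabilityMeasure μ]
    (F : ℤ → MeasurableSpace Ω) (hFle : ∀ i, F i ≤ m) (X : ℕ → ℕ → Ω → ℝ)
    (hXadapted : ∀ (n t : ℕ), Measurable[F (t : ℤ)] (X n t))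
    (β : ℕ → ℝ) (hβpos : ∀ n, 0 < β n) (hβ : Tendsto β atTop atTop)
    (t₀ n₀ : ℕ) (ht₀ : 1 ≤ t₀) (D : ℕ → ℕ → ℕ → Ω → ℝ → ℝ)
    (hD : ∀ (n t s : ℕ), s < t → t ≤ n →
      ∀ ψ : ℝ → ℝ, Measurable ψ → (∃ C, ∀ y, |ψ y| ≤ C) →
        μ[fun ω => ψ ((β (t - s))⁻¹ * (X n t ω - X n s ω)) | F (s : ℤ)]
          =ᵐ[μ] fun ω => ∫ y, ψ y * D n t s ω y)
    (hD7 : ∃ C, ∀ n, n₀ ≤ n → ∀ (t s : ℕ), s < t → t ≤ n → t₀ ≤ t - s →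
      ∀ ω y, D n t s ω y ≤ C)
    (hHL6 : ∃ C, ∀ n : ℕ, 1 ≤ n → (β n / n) * ∑ t ∈ Icc t₀ n, (β t)⁻¹ ≤ C)
    (hHL8 : ∀ q₀ q₁ : ℝ, 0 < q₀ → 0 < q₁ → ∀ ε : ℝ, 0 < ε →
      ∃ η₀ : ℝ, 0 < η₀ ∧ ∀ η : ℝ, 0 < η → η < η₀ → ∃ N : ℕ, ∀ n, N ≤ n →
        ∀ s t : ℕ, (⌊η * n⌋₊ ≤ s ∧ s ≤ ⌊(1 - η) * n⌋₊ ∧ ⌊η * n⌋₊ + s ≤ t ∧ t ≤ n) →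
          ∀ ω y, |y| ≤ q₀ * η ^ q₁ → |D n t s ω y - D n t s ω 0| ≤ ε)
    (hHL9a : ∀ ε : ℝ, 0 < ε → ∃ η₀ : ℝ, 0 < η₀ ∧ ∀ η : ℝ, 0 < η → η < η₀ →
      ∃ N : ℕ, ∀ n, N ≤ n →
        (β n / n) * ∑ t ∈ Icc (⌊(1 - η) * (n : ℝ)⌋₊) n, (β t)⁻¹ ≤ ε)
    (hHL9b : ∀ ε : ℝ, 0 < ε → ∃ η₀ : ℝ, 0 < η₀ ∧ ∀ η : ℝ, 0 < η → η < η₀ →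
      ∃ N : ℕ, ∀ n, N ≤ n →
        (β n / n) * ∑ t ∈ Icc t₀ (⌊η * (n : ℝ)⌋₊), (β t)⁻¹ ≤ ε)
    (hHL9d : ∃ l₀ l₁ : ℝ, 0 < l₀ ∧ 0 < l₁ ∧ ∀ η : ℝ, 0 < η → η < 1 →
      ∀ ε : ℝ, 0 < ε → ∃ N : ℕ, ∀ n, N ≤ n →
        ∀ s t : ℕ, (⌊η * n⌋₊ ≤ s ∧ s ≤ ⌊(1 - η) * n⌋₊ ∧ ⌊η * n⌋₊ + s ≤ t ∧ t ≤ n) →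
          η ^ l₁ / l₀ - ε ≤ (β n)⁻¹ * β (t - s))
    {K : ℝ → ℝ} (hKm : Measurable K) (hK : Integrable K) (hK2 : Integrable fun u => K u ^ 2)
    (h : ℕ → ℝ) (hhpos : ∀ n, 0 < h n)
    (hband1 : Tendsto (fun n => (β n)⁻¹ * h n) atTop (𝓝 0))
    (hband2 : Tendsto (fun n => β n * ((n : ℝ) * h n)⁻¹) atTop (𝓝 0))
    (x : ℝ) {θ ε₁ : ℝ} (hθ : 0 < θ) (hε₁ : 0 < ε₁) :
    ∃ ε, 0 < ε ∧ ε < ε₁ ∧ ∀ f : ℝ → ℝ, Measurable f → Integrable f → (∀ y, 0 ≤ f y) →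
      ∫ y, f y = 1 → (∃ M, ∀ y, f y ≤ M) → (∀ y, ε < |y| → f y = 0) →
      ∃ N : ℕ, ∀ n, N ≤ n →
        (Integrable (fun ω => ((n : ℝ)⁻¹ *
          ∑ t ∈ Icc t₀ n, kernelContrast K f x (β n) (h n) (X n t ω)) ^ 2) μ) ∧
        ∫ ω, ((n : ℝ)⁻¹ *
          ∑ t ∈ Icc t₀ n, kernelContrast K f x (β n) (h n) (X n t ω)) ^ 2 ∂μ ≤ θ := by
  obtain ⟨C', hC'⟩ := hD7
  obtain ⟨w', hw'⟩ := hHL6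
  obtain ⟨l₀, l₁, hl₀, hl₁, hl⟩ := hHL9d
  set C := max C' 0
  set w := max w' 0
  have hC0 : 0 ≤ C := le_max_right _ _
  have hw0 : 0 ≤ w := le_max_right _ _
  set B := 24 * C ^ 2 * (∫ u, |K u|) ^ 2 * w + 8 * C * (∫ u, |K u|) * (∫ u, |K u|) * w ^ 2 with hB
  have hN : 0 ≤ ∫ u, |K u| := integral_nonneg fun _ => abs_nonneg _
  have hB0 : 0 ≤ B := by positivity
  set e := min 1 (θ / (2 * (B + 1)))
  have he : 0 < e := lt_min one_pos (by positivity)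
  have heB : B * e ≤ θ / 2 := by
    have h1 : e ≤ θ / (2 * (B + 1)) := min_le_right _ _
    rw [le_div_iff₀ (by positivity)] at h1
    nlinarith
  obtain ⟨η8, hη8, h8⟩ := hHL8 1 1 one_pos one_pos e he
  obtain ⟨ηa, hηa, h9a⟩ := hHL9a e he
  obtain ⟨ηb, hηb, h9b⟩ := hHL9b e he
  obtain ⟨η, hη, hηlt⟩ := exists_between
    (show (0 : ℝ) < min (min η8 1) (min ηa ηb) by simp [hη8, hηa, hηb])
  simp only [lt_min_iff] at hηlt
  obtain ⟨⟨hη1, hη2⟩, hη3, hη4⟩ := hηlt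
  obtain ⟨N8, hN8⟩ := h8 η hη hη1
  obtain ⟨Na, hNa⟩ := h9a η hη hη3
  obtain ⟨Nb, hNb⟩ := h9b η hη hη4
  have hd : 0 < η ^ l₁ / (2 * l₀) := by positivity
  obtain ⟨Nd, hNd⟩ := hl η hη hη2 _ hd
  set ε := min (ε₁ / 2) (η * (η ^ l₁ / (2 * l₀)) / 2)
  have hε : 0 < ε := lt_min (by positivity) (by positivity)
  refine ⟨ε, hε, (min_le_left _ _).trans_lt (by linarith), ?_⟩
  rintro f hfm hf hf0 hf1 ⟨M, hfM⟩ hfε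
  have hlim : Tendsto (fun n : ℕ =>
      4 * t₀ * C * w * (β n * (n * h n)⁻¹ * (∫ u, K u ^ 2) + (∫ u, K u) ^ 2 * M * (n : ℝ)⁻¹) +
        4 * C * (∫ u, |K u|) * w ^ 2 * (3 * C + 1) *
          ∫ u, {u | ε * β n < |x + h n * u|}.indicator (fun u => |K u|) u) atTop (𝓝 0) := by
    have h1 := tendsto_integral_kernel_tail hKm hK hβpos hβ hband1 x hε
    have h2 := tendsto_inv_atTop_nhds_zero_nat (𝕜 := ℝ)
    have h3 := (((hband2.mul_const (∫ u, K u ^ 2)).add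
      (h2.const_mul ((∫ u, K u) ^ 2 * M))).const_mul (4 * t₀ * C * w)).add
      (h1.const_mul (4 * C * (∫ u, |K u|) * w ^ 2 * (3 * C + 1)))
    simpa using h3
  obtain ⟨N1, hN1⟩ := eventually_atTop.1 (hlim.eventually_le_const (half_pos hθ))
  refine ⟨N1 + N8 + Na + Nb + Nd + n₀ + 1, fun n hn => ?_⟩
  have key := integral_sq_kernel_average_le μ F hFle (X n) (hXadapted n) β hβpos n t₀ ht₀
    (by lia) (D n) (hD n) hC0
    (fun t s hst ht hts ω y => (hC' n (by lia) t s hst ht hts ω y).trans (le_max_left _ _))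
    hKm hK hK2 hfm hf hf0 hf1 hfM hfε (hhpos n) (x := x) hη he.le (min_le_left _ _)
    ⌊η * n⌋₊ ⌊(1 - η) * n⌋₊ (w := w)
    (fun s t _ _ h1 h2 h3 h4 => by
      have h5 := hNd n (by lia) s t ⟨h1, h2, h3, h4⟩
      have h6 : η ^ l₁ / (2 * l₀) ≤ (β n)⁻¹ * β (t - s) := by
        refine le_trans (le_of_eq ?_) h5
        field_simp
        ring
      rw [le_inv_mul_iff₀ (hβpos n)] at h6
      have h7 : ε ≤ η * (η ^ l₁ / (2 * l₀)) / 2 := min_le_right _ _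
      have h8 := mul_le_mul_of_nonneg_right h7 (hβpos n).le
      have h9 := mul_le_mul_of_nonneg_left h6 hη.le
      linarith)
    (fun s t h1 h2 h3 h4 ω y hy => hN8 n (by lia) s t ⟨h1, h2, h3, h4⟩ ω y (by simpa using hy))
    ((hw' n (by lia)).trans (le_max_left _ _)) (hNb n (by lia)) (hNa n (by lia))
  refine ⟨key.1, key.2.trans ?_⟩
  have h1 := hN1 n (by lia)
  have h2 : (24 * C ^ 2 * (∫ u, |K u|) ^ 2 * w + 8 * C * (∫ u, |K u|) ^ 2 * w ^ 2) * e = B * e := by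
    rw [hB]; ring
  linarith

end AsymptoticSecondMoment

section InMeasure

variable {Ω : Type*} [m : MeasurableSpace Ω] {μ : Measure Ω} [IsProbabilityMeasure μ]

lemma tendstoInMeasure_zero_add {U V : ℕ → Ω → ℝ}
    (hU : TendstoInMeasure μ U atTop fun _ => 0) (hV : TendstoInMeasure μ V atTop fun _ => 0) :
    TendstoInMeasure μ (fun n ω => U n ω + V n ω) atTop fun _ => 0 := by
  rw [tendstoInMeasure_iff_measureReal_norm] at *
  intro ε hε
  refine squeeze_zero (fun _ => measureReal_nonneg) (fun n => ?_)
    (by simpa using (hU (ε / 2) (half_pos hε)).add (hV (ε / 2) (half_pos hε)))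
  refine (measureReal_mono ?_).trans (measureReal_union_le _ _)
  intro ω hω
  simp only [Set.mem_ofPred_eq, sub_zero, Set.mem_union, Real.norm_eq_abs] at hω ⊢
  by_contra! hcon
  linarith [abs_add_le (U n ω) (V n ω)]

lemma tendstoInMeasure_zero_const_mul {U : ℕ → Ω → ℝ} (c : ℝ)
    (hU : TendstoInMeasure μ U atTop fun _ => 0) :
    TendstoInMeasure μ (fun n ω => c * U n ω) atTop fun _ => 0 := by
  rw [tendstoInMeasure_iff_measureReal_norm] at *
  intro ε hε
  refine squeeze_zero (fun _ => measureReal_nonneg) (fun n => measureReal_mono ?_)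
    (hU (ε / (|c| + 1)) (by positivity))
  intro ω hω
  simp only [Set.mem_ofPred_eq, sub_zero, Real.norm_eq_abs, abs_mul] at hω ⊢
  rw [div_le_iff₀ (by positivity)]
  nlinarith [abs_nonneg (U n ω)]

lemma tendstoInMeasure_zero_of_integral_abs {U : ℕ → Ω → ℝ} (hUi : ∀ᶠ n in atTop, Integrable (U n) μ)
    (hU : Tendsto (fun n => ∫ ω, |U n ω| ∂μ) atTop (𝓝 0)) :
    TendstoInMeasure μ U atTop fun _ => 0 := by
  rw [tendstoInMeasure_iff_measureReal_norm]
  intro ε hε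
  refine squeeze_zero' (Eventually.of_forall fun _ => measureReal_nonneg) ?_
    (by simpa using hU.const_mul ε⁻¹)
  filter_upwards [hUi] with n hn
  rw [le_inv_mul_iff₀ hε]
  simpa using mul_meas_ge_le_integral_of_nonneg
    (Eventually.of_forall fun ω => abs_nonneg (U n ω)) hn.abs ε

lemma integral_abs_le_of_bdd {V : Ω → ℝ} {B δ : ℝ} (hδ : 0 ≤ δ)
    (hV : ∀ᵐ ω ∂μ, |V ω| ≤ B) :
    ∫ ω, |V ω| ∂μ ≤ δ + B * μ.real {ω | δ ≤ |V ω|} := by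
  set S := toMeasurable μ {ω | δ ≤ |V ω|}
  have hS : MeasurableSet S := measurableSet_toMeasurable _ _
  have hi : Integrable (fun ω => δ + B * S.indicator (fun _ => (1 : ℝ)) ω) μ :=
    (integrable_const _).add (((integrable_const 1).indicator hS).const_mul B)
  calc ∫ ω, |V ω| ∂μ ≤ ∫ ω, (δ + B * S.indicator (fun _ => (1 : ℝ)) ω) ∂μ := by
        refine integral_mono_of_nonneg (Eventually.of_forall fun _ => abs_nonneg _) hi ?_
        filter_upwards [hV] with ω hω
        by_cases h : ω ∈ S
        · rw [Set.indicator_of_mem h]; linarith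
        · rw [Set.indicator_of_notMem h]
          have : ¬ δ ≤ |V ω| := fun h' => h (subset_toMeasurable μ _ h')
          linarith
    _ = δ + B * μ.real {ω | δ ≤ |V ω|} := by
        rw [integral_add (integrable_const _) (((integrable_const 1).indicator hS).const_mul B),
          integral_const_mul, integral_indicator hS]
        simp [S, Measure.real]

lemma tendsto_integral_abs_of_bdd {V : ℕ → Ω → ℝ} {B : ℝ}
    (hB : ∀ᶠ n in atTop, ∀ᵐ ω ∂μ, |V n ω| ≤ B) (hV : TendstoInMeasure μ V atTop fun _ => 0) :
    Tendsto (fun n => ∫ ω, |V n ω| ∂μ) atTop (𝓝 0) := by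
  rw [tendstoInMeasure_iff_measureReal_norm] at hV
  rw [Metric.tendsto_atTop]
  intro ε hε
  have h1 := (hV (ε / 2) (half_pos hε)).const_mul B
  rw [mul_zero] at h1
  obtain ⟨N, hN⟩ := eventually_atTop.1 ((h1.eventually_lt_const (half_pos hε)).and hB)
  refine ⟨N, fun n hn => ?_⟩
  obtain ⟨h2, h3⟩ := hN n hn
  have h4 := integral_abs_le_of_bdd (μ := μ) (V := V n) (half_pos hε).le h3
  simp only [sub_zero, Real.norm_eq_abs] at h2
  rw [Real.dist_eq, sub_zero, abs_of_nonneg (integral_nonneg fun _ => abs_nonneg _)]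
  linarith

/-- A sequence converging weakly to a random variable is tight. -/
lemma exists_tail_le_of_weak_limit {Z : ℕ → Ω → ℝ} (hZ : ∀ n, Measurable (Z n)) {Y : Ω → ℝ}
    (hY : Measurable Y)
    (hweak : ∀ h : ℝ →ᵇ ℝ, Tendsto (fun n => ∫ ω, h (Z n ω) ∂μ) atTop (𝓝 (∫ ω, h (Y ω) ∂μ)))
    {σ : ℝ} (hσ : 0 < σ) : ∃ M : ℕ, ∀ᶠ n in atTop, μ.real {ω | (M : ℝ) ≤ |Z n ω|} ≤ σ := by
  have hc : ∀ M : ℕ, Continuous fun y : ℝ => min 1 (max 0 (|y| - M)) := fun M => by fun_prop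
  have h0 : ∀ (M : ℕ) (y : ℝ), 0 ≤ min 1 (max 0 (|y| - M)) := fun M y =>
    le_min zero_le_one (le_max_left _ _)
  let φ : ℕ → ℝ →ᵇ ℝ := fun M =>
    BoundedContinuousFunction.ofNormedAddCommGroup _ (hc M) 1 fun y => by
      rw [Real.norm_eq_abs, abs_of_nonneg (h0 M y)]
      exact min_le_left _ _
  have hφ : ∀ M y, φ M y = min 1 (max 0 (|y| - M)) := fun M y => rfl
  have hlim : Tendsto (fun M => ∫ ω, φ M (Y ω) ∂μ) atTop (𝓝 (∫ _, (0 : ℝ) ∂μ)) := by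
    refine tendsto_integral_of_dominated_convergence (fun _ => 1)
      (fun M => ((φ M).continuous.measurable.comp hY).aestronglyMeasurable) (integrable_const _)
      (fun M => Eventually.of_forall fun ω => ?_) (Eventually.of_forall fun ω => ?_)
    · rw [hφ, Real.norm_eq_abs, abs_of_nonneg (h0 _ _)]
      exact min_le_left _ _
    · refine tendsto_const_nhds.congr' ?_
      obtain ⟨M₀, hM₀⟩ := exists_nat_ge |Y ω|
      filter_upwards [eventually_ge_atTop M₀] with M hM
      have : (M₀ : ℝ) ≤ M := by exact_mod_cast hM
      rw [hφ, max_eq_left (by linarith), min_eq_right zero_le_one]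
  rw [integral_zero] at hlim
  obtain ⟨M, hM⟩ := (hlim.eventually_lt_const hσ).exists
  refine ⟨M + 1, ?_⟩
  filter_upwards [(hweak (φ M)).eventually_lt_const hM] with n hn
  have hmeas : MeasurableSet {ω | ((M + 1 : ℕ) : ℝ) ≤ |Z n ω|} :=
    measurableSet_le measurable_const (hZ n).abs
  refine le_trans (le_of_eq (integral_indicator_one hmeas).symm) (le_trans ?_ hn.le)
  refine integral_mono_of_nonneg (Eventually.of_forall fun ω => ?_) ?_
    (Eventually.of_forall fun ω => ?_)
  · exact Set.indicator_nonneg (fun _ _ => zero_le_one) _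
  · exact (integrable_const (1 : ℝ)).mono'
      ((φ M).continuous.measurable.comp (hZ n)).aestronglyMeasurable
      (Eventually.of_forall fun ω => by
        rw [hφ, Real.norm_eq_abs, abs_of_nonneg (h0 _ _)]
        exact min_le_left _ _)
  · by_cases h : ((M + 1 : ℕ) : ℝ) ≤ |Z n ω|
    · rw [Set.indicator_of_mem (by exact h)]
      simp only [hφ]
      push_cast at h
      rw [max_eq_right (by linarith), min_eq_left (by linarith)]
      rfl
    · rw [Set.indicator_of_notMem (by exact h)]
      exact h0 _ _

end InMeasure

section FrozenVariable

/-- The nearest point below `z` on the grid of mesh `ρ`, with the value `0` off the cells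
indexed by `S`. -/
lemma abs_sub_sum_indicator_floor_le {u : ℝ → ℝ} {B L ρ : ℝ} (hB : ∀ y, |u y| ≤ B)
    (hL : ∀ y z, |u y - u z| ≤ L * |y - z|) (hL0 : 0 ≤ L) (hρ : 0 < ρ) (S : Finset ℤ) (z : ℝ) :
    |u z - ∑ k ∈ S, {w : ℝ | ⌊w / ρ⌋ = k}.indicator (fun _ => (1 : ℝ)) z * u (k * ρ)| ≤
      L * ρ + B * {w : ℝ | ⌊w / ρ⌋ ∉ S}.indicator (fun _ => (1 : ℝ)) z := by
  by_cases hz : ⌊z / ρ⌋ ∈ S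
  · have h1 : ∑ k ∈ S, {w : ℝ | ⌊w / ρ⌋ = k}.indicator (fun _ => (1 : ℝ)) z * u (k * ρ)
        = u (⌊z / ρ⌋ * ρ) := by
      rw [sum_eq_single_of_mem _ hz]
      · simp
      · intro k _ hk
        rw [Set.indicator_of_notMem (by exact fun h => hk h.symm), zero_mul]
    rw [h1, Set.indicator_of_notMem (by exact fun h => h hz), mul_zero, add_zero]
    refine (hL _ _).trans (mul_le_mul_of_nonneg_left ?_ hL0)
    have h2 := Int.floor_le (z / ρ)
    have h3 := Int.lt_floor_add_one (z / ρ)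
    rw [le_div_iff₀ hρ] at h2
    rw [div_lt_iff₀ hρ] at h3
    rw [abs_le]
    constructor <;> nlinarith
  · have h1 : ∑ k ∈ S, {w : ℝ | ⌊w / ρ⌋ = k}.indicator (fun _ => (1 : ℝ)) z * u (k * ρ) = 0 := by
      refine sum_eq_zero fun k hk => ?_
      rw [Set.indicator_of_notMem (by rintro rfl; exact hz hk), zero_mul]
    rw [h1, sub_zero, Set.indicator_of_mem (by exact hz), mul_one]
    have := hB z
    have := mul_nonneg hL0 hρ.le
    linarith

lemma integral_abs_condExp_comp_add_sub_le {Ω : Type*} {m' m : MeasurableSpace Ω} (hm : m' ≤ m)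
    (μ : Measure Ω) [IsProbabilityMeasure μ] {P Z : Ω → ℝ} (hP : AEMeasurable P μ)
    (hZ : Measurable[m'] Z) {f G : ℝ → ℝ} (hf : Continuous f) (hG : Continuous G) {B L ρ : ℝ}
    (hfB : ∀ y, |f y| ≤ B) (hGB : ∀ y, |G y| ≤ B)
    (hfL : ∀ y z, |f y - f z| ≤ L * |y - z|) (hGL : ∀ y z, |G y - G z| ≤ L * |y - z|)
    (hρ : 0 < ρ) (S : Finset ℤ) :
    ∫ ω, |(μ[fun ω => f (P ω + Z ω) | m']) ω - G (Z ω)| ∂μ ≤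
      2 * (L * ρ + B * μ.real {ω | ⌊Z ω / ρ⌋ ∉ S}) +
        ∑ k ∈ S, ∫ ω, |(μ[fun ω => f (P ω + k * ρ) | m']) ω - G (k * ρ)| ∂μ := by
  have hB0 : 0 ≤ B := (abs_nonneg _).trans (hfB 0)
  have hL0 : 0 ≤ L := by simpa using (abs_nonneg _).trans (hfL 1 0)
  have hZm : Measurable Z := hZ.mono hm le_rfl
  have hcell : ∀ k : ℤ, MeasurableSet {w : ℝ | ⌊w / ρ⌋ = k} := fun k =>
    (Int.measurable_floor.comp (measurable_id.div_const ρ)) (measurableSet_singleton k)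
  have hout : MeasurableSet {w : ℝ | ⌊w / ρ⌋ ∉ S} :=
    (Int.measurable_floor.comp (measurable_id.div_const ρ))
      (Set.to_countable {k | k ∉ S}).measurableSet
  let χ : ℤ → Ω → ℝ := fun k ω => {w : ℝ | ⌊w / ρ⌋ = k}.indicator (fun _ => (1 : ℝ)) (Z ω)
  let χ' : Ω → ℝ := fun ω => {w : ℝ | ⌊w / ρ⌋ ∉ S}.indicator (fun _ => (1 : ℝ)) (Z ω)
  have hχ : ∀ k, StronglyMeasurable[m'] (χ k) := fun k =>
    Measurable.stronglyMeasurable ((measurable_const.indicator (hcell k)).comp hZ)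
  have hχ1 : ∀ k ω, ‖χ k ω‖ ≤ 1 := fun k ω =>
    (norm_indicator_le_norm_self _ _).trans (by simp)
  have hχ'i : Integrable χ' μ :=
    (integrable_const (1 : ℝ)).mono' ((measurable_const.indicator hout).comp hZm).aestronglyMeasurable
      (Eventually.of_forall fun ω => (norm_indicator_le_norm_self _ _).trans (by simp))
  have hχ'int : ∫ ω, χ' ω ∂μ = μ.real {ω | ⌊Z ω / ρ⌋ ∉ S} :=
    integral_indicator_one (hZm hout)
  have hbd : ∀ (u : ℝ → ℝ), Continuous u → (∀ y, |u y| ≤ B) → ∀ {Q : Ω → ℝ}, AEMeasurable Q μ →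
      Integrable (fun ω => u (Q ω)) μ := fun u hu hub Q hQ =>
    (integrable_const B).mono' (hu.measurable.comp_aemeasurable hQ).aestronglyMeasurable
      (Eventually.of_forall fun ω => hub _)
  have hif : Integrable (fun ω => f (P ω + Z ω)) μ := hbd f hf hfB (hP.add hZm.aemeasurable)
  have hik : ∀ k : ℤ, Integrable (fun ω => f (P ω + k * ρ)) μ := fun k =>
    hbd f hf hfB (hP.add_const _)
  have hiχ : ∀ k : ℤ, Integrable (χ k * fun ω => f (P ω + k * ρ)) μ := fun k =>
    (hik k).bdd_mul ((hχ k).mono hm).aestronglyMeasurable (Eventually.of_forall (hχ1 k))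
  have hiG : Integrable (fun ω => G (Z ω)) μ := hbd G hG hGB hZm.aemeasurable
  have hiχG : ∀ k : ℤ, Integrable (fun ω => χ k ω * G (k * ρ)) μ := fun k =>
    (((integrable_const (1 : ℝ)).mono' ((hχ k).mono hm).aestronglyMeasurable
      (Eventually.of_forall (hχ1 k)))).mul_const _
  let Y : Ω → ℝ := ∑ k ∈ S, (χ k * fun ω => f (P ω + k * ρ))
  have hY : Integrable Y μ := integrable_finsetSum' _ fun k _ => hiχ k
  let J : Ω → ℝ := fun ω => ∑ k ∈ S, χ k ω * G (k * ρ)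
  have hJ : Integrable J μ := integrable_finsetSum _ fun k _ => hiχG k
  have hcY : μ[Y | m'] =ᵐ[μ] fun ω => ∑ k ∈ S, χ k ω * (μ[fun ω => f (P ω + k * ρ) | m']) ω := by
    refine (condExp_finsetSum (fun k _ => hiχ k) m').trans ?_
    have hall : ∀ᵐ ω ∂μ, ∀ k : ℤ, (μ[χ k * fun ω => f (P ω + k * ρ) | m']) ω
        = χ k ω * (μ[fun ω => f (P ω + k * ρ) | m']) ω :=
      ae_all_iff.2 fun k => condExp_mul_of_stronglyMeasurable_left (hχ k) (hiχ k) (hik k)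
    filter_upwards [hall] with ω hω
    rw [Finset.sum_apply]
    exact sum_congr rfl fun k _ => hω k
  have e1 : ∫ ω, |f (P ω + Z ω) - Y ω| ∂μ ≤ L * ρ + B * μ.real {ω | ⌊Z ω / ρ⌋ ∉ S} := by
    calc ∫ ω, |f (P ω + Z ω) - Y ω| ∂μ ≤ ∫ ω, (L * ρ + B * χ' ω) ∂μ := by
          refine integral_mono (hif.sub hY).abs ((integrable_const _).add (hχ'i.const_mul B))
            fun ω => ?_
          have := abs_sub_sum_indicator_floor_le (u := fun z => f (P ω + z)) (fun y => hfB _)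
            (fun y z => by simpa using hfL (P ω + y) (P ω + z)) hL0 hρ S (Z ω)
          simpa [Y, Finset.sum_apply] using this
      _ = _ := by
          rw [integral_add (integrable_const _) (hχ'i.const_mul B), integral_const_mul B, hχ'int]
          simp
  have e2 : ∫ ω, |J ω - G (Z ω)| ∂μ ≤ L * ρ + B * μ.real {ω | ⌊Z ω / ρ⌋ ∉ S} := by
    calc ∫ ω, |J ω - G (Z ω)| ∂μ ≤ ∫ ω, (L * ρ + B * χ' ω) ∂μ := by
          refine integral_mono (hJ.sub hiG).abs ((integrable_const _).add (hχ'i.const_mul B))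
            fun ω => ?_
          simp only [abs_sub_comm (J ω)]
          exact abs_sub_sum_indicator_floor_le hGB hGL hL0 hρ S (Z ω)
      _ = _ := by
          rw [integral_add (integrable_const _) (hχ'i.const_mul B), integral_const_mul B, hχ'int]
          simp
  have e3 : ∫ ω, |(μ[fun ω => f (P ω + Z ω) | m']) ω - (μ[Y | m']) ω| ∂μ ≤
      ∫ ω, |f (P ω + Z ω) - Y ω| ∂μ := by
    refine le_trans (le_of_eq (integral_congr_ae ?_)) (integral_abs_condExp_le (m := m')
      (fun ω => f (P ω + Z ω) - Y ω))
    filter_upwards [condExp_sub hif hY m'] with ω hω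
    have : (fun ω => f (P ω + Z ω) - Y ω) = (fun ω => f (P ω + Z ω)) - Y := rfl
    rw [this, hω]
    rfl
  have e4 : ∫ ω, |(μ[Y | m']) ω - J ω| ∂μ ≤
      ∑ k ∈ S, ∫ ω, |(μ[fun ω => f (P ω + k * ρ) | m']) ω - G (k * ρ)| ∂μ := by
    have hi : ∀ k ∈ S, Integrable (fun ω => |(μ[fun ω => f (P ω + k * ρ) | m']) ω - G (k * ρ)|) μ :=
      fun k _ => (integrable_condExp.sub (integrable_const _)).abs
    rw [← integral_finsetSum _ hi]
    refine integral_mono_ae (integrable_condExp.sub hJ).abs (integrable_finsetSum _ hi) ?_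
    filter_upwards [hcY] with ω hω
    rw [hω]
    simp only [J]
    rw [← sum_sub_distrib]
    refine (abs_sum_le_sum_abs _ _).trans (sum_le_sum fun k _ => ?_)
    rw [← mul_sub, abs_mul]
    exact mul_le_of_le_one_left (abs_nonneg _) (hχ1 k ω)
  have i1 : Integrable (fun ω => |(μ[fun ω => f (P ω + Z ω) | m']) ω - (μ[Y | m']) ω|) μ :=
    (integrable_condExp.sub integrable_condExp).abs
  have i2 : Integrable (fun ω => |(μ[Y | m']) ω - J ω|) μ := (integrable_condExp.sub hJ).abs
  have i3 : Integrable (fun ω => |J ω - G (Z ω)|) μ := (hJ.sub hiG).abs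
  have i12 : Integrable (fun ω => |(μ[fun ω => f (P ω + Z ω) | m']) ω - (μ[Y | m']) ω|
      + |(μ[Y | m']) ω - J ω|) μ := i1.add i2
  have e5 : ∫ ω, |(μ[fun ω => f (P ω + Z ω) | m']) ω - G (Z ω)| ∂μ
      ≤ ∫ ω, (|(μ[fun ω => f (P ω + Z ω) | m']) ω - (μ[Y | m']) ω| + |(μ[Y | m']) ω - J ω|
          + |J ω - G (Z ω)|) ∂μ := by
    refine integral_mono (integrable_condExp.sub hiG).abs (i12.add i3) fun ω => ?_
    have h1 := abs_sub_le ((μ[fun ω => f (P ω + Z ω) | m']) ω) ((μ[Y | m']) ω) (G (Z ω))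
    have h2 := abs_sub_le ((μ[Y | m']) ω) (J ω) (G (Z ω))
    simp only
    linarith
  rw [integral_add i12 i3, integral_add i1 i2] at e5
  linarith

end FrozenVariable

section ConditionalLimit

variable {Ω : Type*} {m' : MeasurableSpace Ω} [m : MeasurableSpace Ω] {μ : Measure Ω}
  [IsProbabilityMeasure μ]

lemma eventually_ne_const_of_tendstoInMeasure {U : ℕ → Ω → ℝ} {a c : ℝ}
    (hU : TendstoInMeasure μ U atTop fun _ => c) (hac : a ≠ c) :
    ∀ᶠ n in atTop, U n ≠ fun _ => a := by
  rw [tendstoInMeasure_iff_measureReal_norm] at hU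
  filter_upwards [(hU ‖a - c‖ (norm_pos_iff.2 (sub_ne_zero.2 hac))).eventually_lt_const
    zero_lt_one] with n hn h
  simp [h] at hn

/-- A conditional weak limit with density `Φ` forces `Φ` to be a probability density, and the
converging variables to be eventually measurable. -/
lemma density_of_condExp_weak_limit (hm : m' ≤ m) {P : ℕ → Ω → ℝ} {Φ : ℝ → ℝ}
    (hΦ0 : ∀ y, 0 ≤ Φ y)
    (hlim : ∀ h : ℝ →ᵇ ℝ, TendstoInMeasure μ (fun n => μ[fun ω => h (P n ω) | m']) atTop
      fun _ => ∫ y, h y * Φ y) :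
    Integrable Φ ∧ ∫ y, Φ y = 1 ∧ ∀ᶠ n in atTop, AEMeasurable (P n) μ := by
  have h1 : ∫ y, Φ y = 1 := by
    by_contra hne
    have h2 := hlim 1
    simp only [BoundedContinuousFunction.coe_one, Pi.one_apply, one_mul] at h2
    obtain ⟨n, hn⟩ := (eventually_ne_const_of_tendstoInMeasure h2 (Ne.symm hne)).exists
    exact hn (condExp_const hm 1)
  have hi : Integrable Φ := by
    by_contra hni
    rw [integral_undef hni] at h1
    exact zero_ne_one h1
  refine ⟨hi, h1, ?_⟩
  have hb : ∀ y : ℝ, ‖Real.arctan y + 2‖ ≤ 4 := fun y => by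
    rw [Real.norm_eq_abs, abs_le]
    constructor <;>
      linarith [Real.arctan_lt_pi_div_two y, Real.neg_pi_div_two_lt_arctan y, Real.pi_lt_four]
  have hc : Continuous fun y : ℝ => Real.arctan y + 2 := by fun_prop
  let φ : ℝ →ᵇ ℝ := BoundedContinuousFunction.ofNormedAddCommGroup _ hc 4 hb
  have hφ : ∀ y, φ y = Real.arctan y + 2 := fun y => rfl
  have hpos : 0 < ∫ y, φ y * Φ y := by
    have h3 : (2 - Real.pi / 2) * ∫ y, Φ y ≤ ∫ y, φ y * Φ y := by
      rw [← integral_const_mul]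
      refine integral_mono (hi.const_mul _)
        (hi.bdd_mul φ.continuous.aestronglyMeasurable (Eventually.of_forall hb)) fun y => ?_
      refine mul_le_mul_of_nonneg_right ?_ (hΦ0 y)
      rw [hφ]
      linarith [Real.neg_pi_div_two_lt_arctan y]
    rw [h1] at h3
    linarith [Real.pi_lt_four]
  filter_upwards [eventually_ne_const_of_tendstoInMeasure (hlim φ) hpos.ne] with n hn
  have hint : Integrable (fun ω => φ (P n ω)) μ := by
    by_contra hni
    exact hn (condExp_of_not_integrable hni)
  have h4 : AEMeasurable (fun ω => Real.tan (φ (P n ω) - 2)) μ := by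
    have ht : Measurable Real.tan := by
      have : Real.tan = fun x => Real.sin x / Real.cos x := funext Real.tan_eq_sin_div_cos
      rw [this]
      fun_prop
    exact ht.comp_aemeasurable (hint.aestronglyMeasurable.aemeasurable.sub_const 2)
  simpa [hφ, Real.tan_arctan] using h4

section Smoothing

variable {f Φ : ℝ → ℝ} {B L : ℝ}

lemma integrable_comp_add_mul (hf : Continuous f) (hfB : ∀ y, |f y| ≤ B) (hi : Integrable Φ)
    (a : ℝ) : Integrable fun y => f (y + a) * Φ y :=
  hi.bdd_mul (hf.comp (continuous_add_const a)).aestronglyMeasurable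
    (Eventually.of_forall fun y => hfB (y + a))

lemma abs_integral_comp_add_mul_le (hfB : ∀ y, |f y| ≤ B) (hi : Integrable Φ)
    (hΦ0 : ∀ y, 0 ≤ Φ y) (hΦ1 : ∫ y, Φ y = 1) (a : ℝ) : |∫ y, f (y + a) * Φ y| ≤ B := by
  calc |∫ y, f (y + a) * Φ y| ≤ ∫ y, B * Φ y := by
        rw [← Real.norm_eq_abs]
        refine norm_integral_le_of_norm_le (hi.const_mul B) (Eventually.of_forall fun y => ?_)
        rw [Real.norm_eq_abs, abs_mul, abs_of_nonneg (hΦ0 y)]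
        exact mul_le_mul_of_nonneg_right (hfB _) (hΦ0 y)
    _ = B := by rw [integral_const_mul, hΦ1, mul_one]

lemma abs_integral_comp_add_mul_sub_le (hf : Continuous f) (hfB : ∀ y, |f y| ≤ B)
    (hfL : ∀ y z, |f y - f z| ≤ L * |y - z|) (hi : Integrable Φ)
    (hΦ0 : ∀ y, 0 ≤ Φ y) (hΦ1 : ∫ y, Φ y = 1) (a b : ℝ) :
    |(∫ y, f (y + a) * Φ y) - ∫ y, f (y + b) * Φ y| ≤ L * |a - b| := by
  rw [← integral_sub (integrable_comp_add_mul hf hfB hi a) (integrable_comp_add_mul hf hfB hi b)]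
  calc |∫ y, (f (y + a) * Φ y - f (y + b) * Φ y)| ≤ ∫ y, L * |a - b| * Φ y := by
        rw [← Real.norm_eq_abs]
        refine norm_integral_le_of_norm_le (hi.const_mul _) (Eventually.of_forall fun y => ?_)
        rw [Real.norm_eq_abs, ← sub_mul, abs_mul, abs_of_nonneg (hΦ0 y)]
        refine mul_le_mul_of_nonneg_right ((hfL _ _).trans_eq ?_) (hΦ0 y)
        rw [add_sub_add_left_eq_sub]
    _ = L * |a - b| := by rw [integral_const_mul, hΦ1, mul_one]

lemma continuous_integral_comp_add_mul (hf : Continuous f) (hfB : ∀ y, |f y| ≤ B)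
    (hfL : ∀ y z, |f y - f z| ≤ L * |y - z|) (hi : Integrable Φ)
    (hΦ0 : ∀ y, 0 ≤ Φ y) (hΦ1 : ∫ y, Φ y = 1) : Continuous fun a => ∫ y, f (y + a) * Φ y := by
  have hL0 : 0 ≤ L := by simpa using (abs_nonneg _).trans (hfL 1 0)
  refine (LipschitzWith.of_dist_le_mul (K := L.toNNReal) fun a b => ?_).continuous
  simpa [Real.dist_eq, hL0] using abs_integral_comp_add_mul_sub_le hf hfB hfL hi hΦ0 hΦ1 a b

end Smoothing

lemma tendsto_integral_abs_condExp_comp_sub (hm : m' ≤ m) {P Z V : ℕ → Ω → ℝ} {Φ f : ℝ → ℝ}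
    {B L : ℝ} (hV : ∀ n, Measurable (V n)) (hZ : ∀ n, Measurable[m'] (Z n))
    (hVPZ : TendstoInMeasure μ (fun n ω => V n ω - (P n ω + Z n ω)) atTop fun _ => 0)
    (hΦ0 : ∀ y, 0 ≤ Φ y)
    (hlim : ∀ h : ℝ →ᵇ ℝ, TendstoInMeasure μ (fun n => μ[fun ω => h (P n ω) | m']) atTop
      fun _ => ∫ y, h y * Φ y)
    (htight : ∀ σ : ℝ, 0 < σ → ∃ M : ℕ, ∀ᶠ n in atTop, μ.real {ω | (M : ℝ) ≤ |Z n ω|} ≤ σ)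
    (hf : Continuous f) (hfB : ∀ y, |f y| ≤ B) (hfL : ∀ y z, |f y - f z| ≤ L * |y - z|) :
    Tendsto (fun n => ∫ ω, |(μ[fun ω => f (V n ω) | m']) ω - ∫ y, f (y + Z n ω) * Φ y| ∂μ)
      atTop (𝓝 0) := by
  obtain ⟨hi, hΦ1, hPm⟩ := density_of_condExp_weak_limit hm hΦ0 hlim
  have hB0 : 0 ≤ B := (abs_nonneg _).trans (hfB 0)
  have hL0 : 0 ≤ L := by simpa using (abs_nonneg _).trans (hfL 1 0)
  set G : ℝ → ℝ := fun a => ∫ y, f (y + a) * Φ y with hGdef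
  have hGB : ∀ a, |G a| ≤ B := abs_integral_comp_add_mul_le hfB hi hΦ0 hΦ1
  have hGL : ∀ a b, |G a - G b| ≤ L * |a - b| :=
    abs_integral_comp_add_mul_sub_le hf hfB hfL hi hΦ0 hΦ1
  have hG : Continuous G := continuous_integral_comp_add_mul hf hfB hfL hi hΦ0 hΦ1
  have hgrid : ∀ a : ℝ, Tendsto (fun n => ∫ ω, |(μ[fun ω => f (P n ω + a) | m']) ω - G a| ∂μ)
      atTop (𝓝 0) := by
    intro a
    let φ : ℝ →ᵇ ℝ := BoundedContinuousFunction.ofNormedAddCommGroup _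
      (hf.comp (continuous_add_const a)) B fun y => hfB (y + a)
    refine tendsto_integral_abs_of_bdd (B := B + B) (Eventually.of_forall fun n => ?_) ?_
    · filter_upwards [ae_bdd_abs_condExp_of_ae_bdd_abs (m := m') (μ := μ)
        (Eventually.of_forall fun ω => hfB (P n ω + a))]
        with ω hω
      exact (abs_sub _ _).trans (add_le_add hω (hGB a))
    · have := hlim φ
      rw [tendstoInMeasure_iff_measureReal_norm] at this ⊢
      intro ε hε
      simpa [φ, hGdef] using this ε hε
  have happrox : Tendsto (fun n => ∫ ω, |f (V n ω) - f (P n ω + Z n ω)| ∂μ) atTop (𝓝 0) := by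
    refine tendsto_integral_abs_of_bdd (B := B + B)
      (Eventually.of_forall fun n => Eventually.of_forall fun ω =>
        (abs_sub _ _).trans (add_le_add (hfB _) (hfB _))) ?_
    have := tendstoInMeasure_zero_const_mul L hVPZ
    rw [tendstoInMeasure_iff_measureReal_norm] at this ⊢
    intro ε hε
    refine squeeze_zero (fun _ => measureReal_nonneg) (fun n => measureReal_mono ?_) (this ε hε)
    intro ω hω
    simp only [Set.mem_ofPred_eq, sub_zero, Real.norm_eq_abs, abs_mul, abs_of_nonneg hL0]
      at hω ⊢
    exact hω.trans (hfL _ _)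
  rw [Metric.tendsto_atTop]
  intro θ hθ
  obtain ⟨M, hM⟩ := htight (θ / (8 * (B + 1))) (by positivity)
  set ρ : ℝ := θ / (8 * (L + 1)) with hρdef
  have hρ : 0 < ρ := by positivity
  set k : ℤ := ⌈(M : ℝ) / ρ⌉ + 1
  have hsum := tendsto_finsetSum (Finset.Icc (-k) k) fun (j : ℤ) _ => hgrid (j * ρ)
  rw [sum_const_zero] at hsum
  have h8 : 0 < θ / 8 := by positivity
  obtain ⟨N, hN⟩ := eventually_atTop.1 (hM.and (hPm.and
    ((hsum.eventually_lt_const h8).and (happrox.eventually_lt_const h8))))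
  refine ⟨N, fun n hn => ?_⟩
  obtain ⟨h1, h2, h3, h4⟩ := hN n hn
  have hZm : Measurable (Z n) := (hZ n).mono hm le_rfl
  have h5 := integral_abs_condExp_comp_add_sub_le hm μ h2 (hZ n) hf hG hfB hGB hfL hGL hρ
    (Finset.Icc (-k) k)
  have h6 : μ.real {ω | ⌊Z n ω / ρ⌋ ∉ Finset.Icc (-k) k} ≤ θ / (8 * (B + 1)) := by
    refine (measureReal_mono fun ω hω => ?_).trans h1
    simp only [Set.mem_ofPred_eq] at hω ⊢
    by_contra! hlt
    refine hω (Finset.mem_Icc.2 ?_)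
    have h7 : |Z n ω / ρ| < k := by
      rw [abs_div, abs_of_pos hρ]
      have := Int.le_ceil ((M : ℝ) / ρ)
      have h8 : |Z n ω| / ρ < M / ρ := div_lt_div_of_pos_right hlt hρ
      simp only [k]
      push_cast
      linarith
    rw [abs_lt] at h7
    refine ⟨Int.le_floor.2 (by push_cast; exact h7.1.le), Int.floor_le_iff.2 ?_⟩
    linarith [h7.2]
  have e1 : L * ρ ≤ θ / 8 := by
    rw [hρdef, mul_div_assoc', div_le_div_iff₀ (by positivity) (by norm_num)]
    nlinarith
  have e2 : B * (θ / (8 * (B + 1))) ≤ θ / 8 := by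
    rw [mul_div_assoc', div_le_div_iff₀ (by positivity) (by norm_num)]
    nlinarith
  have e3 := mul_le_mul_of_nonneg_left h6 hB0
  have iV : Integrable (fun ω => f (V n ω)) μ :=
    Integrable.of_bound (hf.measurable.comp (hV n)).aestronglyMeasurable B
      (Eventually.of_forall fun ω => hfB _)
  have iP : Integrable (fun ω => f (P n ω + Z n ω)) μ :=
    Integrable.of_bound
      (hf.measurable.comp_aemeasurable (h2.add hZm.aemeasurable)).aestronglyMeasurable B
      (Eventually.of_forall fun ω => hfB _)
  have iG : Integrable (fun ω => G (Z n ω)) μ :=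
    Integrable.of_bound (hG.measurable.comp hZm).aestronglyMeasurable B
      (Eventually.of_forall fun ω => hGB _)
  have e4 : ∫ ω, |(μ[fun ω => f (V n ω) | m']) ω - (μ[fun ω => f (P n ω + Z n ω) | m']) ω| ∂μ ≤
      ∫ ω, |f (V n ω) - f (P n ω + Z n ω)| ∂μ := by
    refine le_trans (le_of_eq (integral_congr_ae ?_)) (integral_abs_condExp_le (m := m')
      (fun ω => f (V n ω) - f (P n ω + Z n ω)))
    filter_upwards [condExp_sub iV iP m'] with ω hω
    have : (fun ω => f (V n ω) - f (P n ω + Z n ω)) =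
      (fun ω => f (V n ω)) - fun ω => f (P n ω + Z n ω) := rfl
    rw [this, hω]
    rfl
  have i1 : Integrable (fun ω => |(μ[fun ω => f (V n ω) | m']) ω -
      (μ[fun ω => f (P n ω + Z n ω) | m']) ω|) μ := (integrable_condExp.sub integrable_condExp).abs
  have i2 : Integrable (fun ω => |(μ[fun ω => f (P n ω + Z n ω) | m']) ω - G (Z n ω)|) μ :=
    (integrable_condExp.sub iG).abs
  have e5 : ∫ ω, |(μ[fun ω => f (V n ω) | m']) ω - G (Z n ω)| ∂μ ≤
      ∫ ω, (|(μ[fun ω => f (V n ω) | m']) ω - (μ[fun ω => f (P n ω + Z n ω) | m']) ω| +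
        |(μ[fun ω => f (P n ω + Z n ω) | m']) ω - G (Z n ω)|) ∂μ :=
    integral_mono (integrable_condExp.sub iG).abs (i1.add i2) fun ω => abs_sub_le _ _ _
  rw [integral_add i1 i2] at e5
  rw [Real.dist_eq, sub_zero, abs_of_nonneg (integral_nonneg fun ω => abs_nonneg _)]
  linarith

lemma tendsto_average_zero {a : ℕ → ℕ → ℝ} {C : ℝ} (h0 : ∀ n t, 0 ≤ a n t)
    (hC : ∀ n t, a n t ≤ C)
    (ha : ∀ δ : ℝ, 0 < δ → δ < 1 → ∀ tseq : ℕ → ℕ,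
      (∀ n : ℕ, ⌊(n : ℝ) * δ⌋₊ ≤ tseq n ∧ tseq n ≤ n) →
      Tendsto (fun n => a n (tseq n)) atTop (𝓝 0)) :
    Tendsto (fun n : ℕ => (n : ℝ)⁻¹ * ∑ t ∈ Icc 1 n, a n t) atTop (𝓝 0) := by
  have hC0 : 0 ≤ C := (h0 0 0).trans (hC 0 0)
  rw [Metric.tendsto_atTop]
  intro ε hε
  obtain ⟨δ, hδ0, hδ1, hδC⟩ : ∃ δ : ℝ, 0 < δ ∧ δ < 1 ∧ C * δ ≤ ε / 4 := by
    refine ⟨min (1 / 2) (ε / (4 * (C + 1))), by positivity,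
      (min_le_left _ _).trans_lt (by norm_num), ?_⟩
    refine (mul_le_mul_of_nonneg_left (min_le_right _ _) hC0).trans ?_
    rw [mul_div_assoc', div_le_div_iff₀ (by positivity) (by norm_num)]
    nlinarith
  have hfl : ∀ n : ℕ, ⌊(n : ℝ) * δ⌋₊ ≤ n := fun n =>
    Nat.floor_le_of_le (mul_le_of_le_one_right n.cast_nonneg hδ1.le)
  have hmax : ∀ n : ℕ, ∃ t ∈ Icc ⌊(n : ℝ) * δ⌋₊ n, ∀ s ∈ Icc ⌊(n : ℝ) * δ⌋₊ n, a n s ≤ a n t :=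
    fun n => exists_max_image _ _ ⟨n, mem_Icc.2 ⟨hfl n, le_rfl⟩⟩
  choose tseq htseq htmax using hmax
  have hlim := ha δ hδ0 hδ1 tseq fun n => mem_Icc.1 (htseq n)
  obtain ⟨N, hN⟩ := eventually_atTop.1
    ((hlim.eventually_lt_const (half_pos hε)).and (eventually_gt_atTop 0))
  refine ⟨N, fun n hn => ?_⟩
  obtain ⟨h1, hnpos⟩ := hN n hn
  have hn0 : (0 : ℝ) < n := by exact_mod_cast hnpos
  have hterm : ∀ t ∈ Icc 1 n,
      a n t ≤ (if t ∈ range ⌊(n : ℝ) * δ⌋₊ then C else 0) + a n (tseq n) := by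
    intro t ht
    split_ifs with h
    · linarith [hC n t, h0 n (tseq n)]
    · rw [zero_add]
      exact htmax n t (mem_Icc.2 ⟨by simpa using h, (mem_Icc.1 ht).2⟩)
  have hcard : ∑ t ∈ Icc 1 n, (if t ∈ range ⌊(n : ℝ) * δ⌋₊ then C else 0) ≤ n * (ε / 4) := by
    calc ∑ t ∈ Icc 1 n, (if t ∈ range ⌊(n : ℝ) * δ⌋₊ then C else 0)
        = ∑ t ∈ (Icc 1 n).filter (· ∈ range ⌊(n : ℝ) * δ⌋₊), C := by rw [sum_filter]
      _ ≤ ∑ t ∈ range ⌊(n : ℝ) * δ⌋₊, C :=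
          sum_le_sum_of_subset_of_nonneg (fun t ht => (mem_filter.1 ht).2) fun _ _ _ => hC0
      _ = ⌊(n : ℝ) * δ⌋₊ * C := by simp
      _ ≤ (n * δ) * C := mul_le_mul_of_nonneg_right (Nat.floor_le (by positivity)) hC0
      _ ≤ n * (ε / 4) := by nlinarith
  have hsum := sum_le_sum hterm
  rw [sum_add_distrib, sum_const, Nat.card_Icc, Nat.add_sub_cancel, nsmul_eq_mul] at hsum
  rw [Real.dist_eq, sub_zero, abs_of_nonneg
    (mul_nonneg (inv_nonneg.2 hn0.le) (sum_nonneg fun t _ => h0 n t)), inv_mul_lt_iff₀ hn0]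
  nlinarith

/-- Averages of a bounded Lipschitz function of the array are asymptotically a mixture of
translates of the density `Φ`. -/
lemma tendstoInMeasure_average_sub_mixture (hm : m' ≤ m) {X Xp Xm R : ℕ → ℕ → Ω → ℝ}
    (hXmeas : ∀ n t, Measurable (X n t)) {β : ℕ → ℝ} (hβpos : ∀ n, 0 < β n)
    (hdecomp : ∀ n t ω, X n t ω = Xp n t ω + Xm n t ω + R n t ω)
    (hXmF0 : ∀ n t, Measurable[m'] (Xm n t))
    (hRneg : ∀ ε : ℝ, 0 < ε → ∀ δ : ℝ, 0 < δ → ∃ N, ∀ n, N ≤ n →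
      ∀ t, 1 ≤ t → t ≤ n → (μ {ω | ε < (β n)⁻¹ * |R n t ω|}).toReal ≤ δ)
    {Xminus : Ω → ℝ} (hXminusMeas : Measurable Xminus) {Φ : ℝ → ℝ} (hΦdens : ∀ y, 0 ≤ Φ y)
    (hHL2a : ∀ δ : ℝ, 0 < δ → δ < 1 → ∀ tseq : ℕ → ℕ,
      (∀ n : ℕ, ⌊(n : ℝ) * δ⌋₊ ≤ tseq n ∧ tseq n ≤ n) →
      ∀ h : ℝ →ᵇ ℝ,
        TendstoInMeasure μ
          (fun n => μ[fun ω => h ((β n)⁻¹ * Xp n (tseq n) ω) | m']) atTop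
          (fun _ => ∫ y, h y * Φ y))
    (hHL2b : ∀ δ : ℝ, 0 < δ → δ < 1 → ∀ tseq : ℕ → ℕ,
      (∀ n : ℕ, ⌊(n : ℝ) * δ⌋₊ ≤ tseq n ∧ tseq n ≤ n) →
      (∀ h : ℝ →ᵇ ℝ,
        Tendsto (fun n => ∫ ω, h ((β n)⁻¹ * Xm n (tseq n) ω) ∂μ) atTop
          (𝓝 (∫ ω, h (Xminus ω) ∂μ))) ∧
      TendstoInMeasure μ
        (fun (n : ℕ) ω => (β n)⁻¹ * (Xm n n ω - Xm n (tseq n) ω)) atTop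
        (fun _ => 0))
    {f : ℝ → ℝ} {B L : ℝ} (hf : Continuous f) (hfB : ∀ y, |f y| ≤ B)
    (hfL : ∀ y z, |f y - f z| ≤ L * |y - z|)
    (hHL4 : TendstoInMeasure μ
        (fun (n : ℕ) ω => (n : ℝ)⁻¹ * ∑ t ∈ Icc 1 n,
          (f ((β n)⁻¹ * X n t ω) - (μ[fun ω' => f ((β n)⁻¹ * X n t ω') | m']) ω))
        atTop (fun _ => 0)) :
    TendstoInMeasure μ (fun (n : ℕ) ω => (n : ℝ)⁻¹ * ∑ t ∈ Icc 1 n, f ((β n)⁻¹ * X n t ω) -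
      ∫ y, f (y + (β n)⁻¹ * Xm n n ω) * Φ y) atTop (fun _ => 0) := by
  have hlast : ∀ n : ℕ, ⌊(n : ℝ) * (1 / 2)⌋₊ ≤ n ∧ n ≤ n := fun n =>
    ⟨Nat.floor_le_of_le (mul_le_of_le_one_right n.cast_nonneg (by norm_num)), le_rfl⟩
  obtain ⟨hi, hΦ1, -⟩ := density_of_condExp_weak_limit hm hΦdens
    (hHL2a (1 / 2) (by norm_num) (by norm_num) (fun n => n) hlast)
  have hZ : ∀ n, Measurable[m'] fun ω => (β n)⁻¹ * Xm n n ω := fun n => (hXmF0 n n).const_mul _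
  have hZm : ∀ n, Measurable fun ω => (β n)⁻¹ * Xm n n ω := fun n => (hZ n).mono hm le_rfl
  have htight : ∀ σ : ℝ, 0 < σ → ∃ M : ℕ, ∀ᶠ n in atTop,
      μ.real {ω | (M : ℝ) ≤ |(β n)⁻¹ * Xm n n ω|} ≤ σ := fun σ hσ =>
    exists_tail_le_of_weak_limit hZm hXminusMeas
      (hHL2b (1 / 2) (by norm_num) (by norm_num) (fun n => n) hlast).1 hσ
  set G : ℝ → ℝ := fun a => ∫ y, f (y + a) * Φ y with hGdef
  have hGB : ∀ a, |G a| ≤ B := abs_integral_comp_add_mul_le hfB hi hΦdens hΦ1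
  have hG : Continuous G := continuous_integral_comp_add_mul hf hfB hfL hi hΦdens hΦ1
  have iG : ∀ n, Integrable (fun ω => G ((β n)⁻¹ * Xm n n ω)) μ := fun n =>
    Integrable.of_bound (hG.measurable.comp (hZm n)).aestronglyMeasurable B
      (Eventually.of_forall fun ω => hGB _)
  let E : ℕ → ℕ → Ω → ℝ := fun n t => μ[fun ω' => f ((β n)⁻¹ * X n t ω') | m']
  have hE : ∀ n t, Integrable (E n t) μ := fun n t => integrable_condExp
  have iEG : ∀ n t, Integrable (fun ω => E n t ω - G ((β n)⁻¹ * Xm n n ω)) μ := fun n t =>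
    (hE n t).sub (iG n)
  have iEGa : ∀ n t, Integrable (fun ω => |E n t ω - G ((β n)⁻¹ * Xm n n ω)|) μ := fun n t =>
    (iEG n t).abs
  have hEB : ∀ n t, ∀ᵐ ω ∂μ, |E n t ω| ≤ B := fun n t =>
    ae_bdd_abs_condExp_of_ae_bdd_abs (Eventually.of_forall fun ω => hfB _)
  have havg : Tendsto (fun n : ℕ => (n : ℝ)⁻¹ * ∑ t ∈ Icc 1 n,
      ∫ ω, |E n t ω - G ((β n)⁻¹ * Xm n n ω)| ∂μ) atTop (𝓝 0) := by
    refine tendsto_average_zero (C := B + B) (fun n t => integral_nonneg fun ω => abs_nonneg _)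
      (fun n t => ?_) fun δ hδ0 hδ1 tseq htseq => ?_
    · calc ∫ ω, |E n t ω - G ((β n)⁻¹ * Xm n n ω)| ∂μ ≤ ∫ _, (B + B) ∂μ := by
            refine integral_mono_ae (iEGa n t) (integrable_const _) ?_
            filter_upwards [hEB n t] with ω hω
            exact (abs_sub _ _).trans (add_le_add hω (hGB _))
        _ = B + B := by simp
    · refine tendsto_integral_abs_condExp_comp_sub hm
        (fun n => (hXmeas n (tseq n)).const_mul _) hZ ?_ hΦdens
        (hHL2a δ hδ0 hδ1 tseq htseq) htight hf hfB hfL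
      have hR : TendstoInMeasure μ (fun n ω => (β n)⁻¹ * R n (tseq n) ω) atTop fun _ => 0 := by
        rw [tendstoInMeasure_iff_measureReal_norm]
        intro ε hε
        rw [Metric.tendsto_atTop]
        intro σ hσ
        obtain ⟨N, hN⟩ := hRneg (ε / 2) (half_pos hε) (σ / 2) (half_pos hσ)
        obtain ⟨N', hN'⟩ := exists_nat_gt (1 / δ)
        refine ⟨max N N', fun n hn => ?_⟩
        have ht1 : 1 ≤ tseq n := by
          refine le_trans (Nat.le_floor ?_) (htseq n).1
          have : (N' : ℝ) ≤ n := by exact_mod_cast (le_max_right _ _).trans hn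
          rw [div_lt_iff₀ hδ0] at hN'
          push_cast
          nlinarith
        rw [Real.dist_eq, sub_zero, abs_of_nonneg measureReal_nonneg]
        refine lt_of_le_of_lt (le_trans (measureReal_mono ?_)
          (hN n ((le_max_left _ _).trans hn) (tseq n) ht1 (htseq n).2)) (half_lt_self hσ)
        intro ω hω
        simp only [Set.mem_ofPred_eq, sub_zero, Real.norm_eq_abs, abs_mul, abs_inv,
          abs_of_pos (hβpos n)] at hω ⊢
        linarith
      convert tendstoInMeasure_zero_add hR (tendstoInMeasure_zero_const_mul (-1)
        (hHL2b δ hδ0 hδ1 tseq htseq).2) using 3 with n ω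
      rw [hdecomp]
      ring
  have hW : TendstoInMeasure μ (fun (n : ℕ) ω => (n : ℝ)⁻¹ * ∑ t ∈ Icc 1 n,
      (E n t ω - G ((β n)⁻¹ * Xm n n ω))) atTop fun _ => 0 := by
    refine tendstoInMeasure_zero_of_integral_abs (Eventually.of_forall fun n =>
      (integrable_finsetSum _ fun t _ => iEG n t).const_mul _) ?_
    refine squeeze_zero (fun n => integral_nonneg fun ω => abs_nonneg _) (fun n => ?_) havg
    rw [← integral_finsetSum _ fun t _ => (iEGa n t), ← integral_const_mul]
    refine integral_mono
      ((integrable_finsetSum _ fun t _ => iEG n t).const_mul _).abs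
      ((integrable_finsetSum _ fun t _ => (iEGa n t)).const_mul _) fun ω => ?_
    simp only [abs_mul, abs_inv, Nat.abs_cast]
    exact mul_le_mul_of_nonneg_left (abs_sum_le_sum_abs _ _) (by positivity)
  refine (tendstoInMeasure_zero_add hHL4 hW).congr' ?_ (Eventually.of_forall fun _ => rfl)
  filter_upwards [eventually_gt_atTop 0] with n hn
  refine Eventually.of_forall fun ω => ?_
  have hn0 : (n : ℝ) ≠ 0 := by exact_mod_cast hn.ne'
  simp only [sum_sub_distrib, sum_const, Nat.card_Icc, Nat.add_sub_cancel, nsmul_eq_mul, E]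
  field_simp
  ring

end ConditionalLimit

section Mollification

lemma exists_lipschitz_mollifier {ε : ℝ} (hε : 0 < ε) :
    ∃ f : ℝ → ℝ, Continuous f ∧ Integrable f ∧ (∀ y, 0 ≤ f y) ∧ ∫ y, f y = 1 ∧
      (∃ M, ∀ y, f y ≤ M) ∧ (∀ y, ε < |y| → f y = 0) ∧ ∃ L, LipschitzWith L f := by
  let b : ContDiffBump (0 : ℝ) := ⟨ε / 2, ε, by positivity, by linarith⟩
  refine ⟨b.normed volume, b.continuous_normed, b.integrable_normed, b.nonneg_normed,
    b.integral_normed, ⟨_, b.normed_le_div_measure_closedBall_rIn volume⟩, fun y hy => ?_, ?_⟩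
  · by_contra hne
    have : y ∈ Metric.ball (0 : ℝ) ε := by
      rw [← show b.rOut = ε from rfl, ← b.support_normed_eq (μ := volume)]
      exact hne
    rw [Metric.mem_ball, Real.dist_eq, sub_zero] at this
    linarith
  · exact ContDiff.lipschitzWith_of_hasCompactSupport (𝕂 := ℝ) (n := 1)
      b.hasCompactSupport_normed b.contDiff_normed one_ne_zero

variable {f Φ : ℝ → ℝ} {C : ℝ}

lemma integrable_mollifier_mul (hf : Integrable f) (hΦ : Continuous Φ) (hΦ0 : ∀ y, 0 ≤ Φ y)
    (hΦC : ∀ y, Φ y ≤ C) (a : ℝ) : Integrable fun y => f (y + a) * Φ y :=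
  (hf.comp_add_right a).mul_bdd hΦ.aestronglyMeasurable
    (Eventually.of_forall fun y => by rw [Real.norm_eq_abs, abs_of_nonneg (hΦ0 y)]; exact hΦC y)

lemma abs_integral_mollifier_mul_le (hf : Integrable f) (hf0 : ∀ y, 0 ≤ f y)
    (hf1 : ∫ y, f y = 1) (hΦ0 : ∀ y, 0 ≤ Φ y)
    (hΦC : ∀ y, Φ y ≤ C) (a : ℝ) : |∫ y, f (y + a) * Φ y| ≤ C := by
  calc |∫ y, f (y + a) * Φ y| ≤ ∫ y, f (y + a) * C := by
        rw [← Real.norm_eq_abs]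
        refine norm_integral_le_of_norm_le ((hf.comp_add_right a).mul_const C)
          (Eventually.of_forall fun y => ?_)
        rw [Real.norm_eq_abs, abs_mul, abs_of_nonneg (hΦ0 y), abs_of_nonneg (hf0 _)]
        exact mul_le_mul_of_nonneg_left (hΦC y) (hf0 _)
    _ = C := by
        rw [integral_mul_const, integral_add_right_eq_self f a, hf1, one_mul]

lemma abs_integral_mollifier_mul_sub_le (hf : Integrable f) (hf0 : ∀ y, 0 ≤ f y)
    (hf1 : ∫ y, f y = 1) {ε η : ℝ} (hfε : ∀ y, ε < |y| → f y = 0) (hΦ : Continuous Φ)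
    (hΦ0 : ∀ y, 0 ≤ Φ y) (hΦC : ∀ y, Φ y ≤ C) (a : ℝ)
    (hη : ∀ y, |y + a| ≤ ε → |Φ y - Φ (-a)| ≤ η) :
    |(∫ y, f (y + a) * Φ y) - Φ (-a)| ≤ η := by
  have h1 : Φ (-a) = ∫ y, f (y + a) * Φ (-a) := by
    rw [integral_mul_const, integral_add_right_eq_self f a, hf1, one_mul]
  have h2 : (∫ y, f (y + a) * Φ y) - Φ (-a) = ∫ y, f (y + a) * (Φ y - Φ (-a)) := by
    conv_lhs => rw [h1]
    rw [← integral_sub (integrable_mollifier_mul hf hΦ hΦ0 hΦC a)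
      ((hf.comp_add_right a).mul_const _)]
    simp only [mul_sub]
  calc |(∫ y, f (y + a) * Φ y) - Φ (-a)| ≤ ∫ y, f (y + a) * η := by
        rw [h2, ← Real.norm_eq_abs]
        refine norm_integral_le_of_norm_le ((hf.comp_add_right a).mul_const η)
          (Eventually.of_forall fun y => ?_)
        rw [Real.norm_eq_abs, abs_mul, abs_of_nonneg (hf0 _)]
        by_cases hy : |y + a| ≤ ε
        · exact mul_le_mul_of_nonneg_left (hη y hy) (hf0 _)
        · simp [hfε _ (not_le.1 hy)]
    _ = η := by
        rw [integral_mul_const, integral_add_right_eq_self f a, hf1, one_mul]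

lemma tendsto_integral_mollifier_mul {φ : ℝ → ℝ → ℝ} (hφ : ∀ ε, 0 < ε → Integrable (φ ε))
    (hφ0 : ∀ ε, 0 < ε → ∀ y, 0 ≤ φ ε y) (hφ1 : ∀ ε, 0 < ε → ∫ y, φ ε y = 1)
    (hφε : ∀ ε, 0 < ε → ∀ y, ε < |y| → φ ε y = 0) (hΦ : Continuous Φ)
    (hΦ0 : ∀ y, 0 ≤ Φ y) (hΦC : ∀ y, Φ y ≤ C) (a : ℝ) :
    Tendsto (fun ε => ∫ y, φ ε (y + a) * Φ y) (𝓝[>] 0) (𝓝 (Φ (-a))) := by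
  rw [Metric.tendsto_nhds]
  intro η hη
  obtain ⟨δ, hδ, hδΦ⟩ := Metric.continuousAt_iff.1 (hΦ.continuousAt (x := -a)) (η / 2) (half_pos hη)
  filter_upwards [Ioo_mem_nhdsGT hδ] with ε hε
  refine lt_of_le_of_lt (abs_integral_mollifier_mul_sub_le (hφ ε hε.1) (hφ0 ε hε.1) (hφ1 ε hε.1)
    (hφε ε hε.1) hΦ hΦ0 hΦC a fun y hy => (hδΦ ?_).le) (half_lt_self hη)
  rw [Real.dist_eq, sub_neg_eq_add]
  exact hy.trans_lt hε.2

end Mollification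

section Approximation

variable {Ω : Type*} [m : MeasurableSpace Ω] {μ : Measure Ω} [IsProbabilityMeasure μ]

/-- Convergence of `∫ g (S n)` when `S n` is close in probability to bounded variables whose
images under `g` have nearly the right limiting expectation. -/
lemma tendsto_integral_of_approx_in_measure {S : ℕ → Ω → ℝ} (hS : ∀ n, Measurable (S n))
    (g : ℝ →ᵇ ℝ) {ℓ C : ℝ}
    (happ : ∀ σ : ℝ, 0 < σ → ∀ δ : ℝ, 0 < δ → ∃ T : ℕ → Ω → ℝ, (∀ n, Measurable (T n)) ∧
      (∀ n ω, |T n ω| ≤ C) ∧ (∀ᶠ n in atTop, μ.real {ω | δ ≤ |S n ω - T n ω|} ≤ σ) ∧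
      ∃ ℓ', Tendsto (fun n => ∫ ω, g (T n ω) ∂μ) atTop (𝓝 ℓ') ∧ |ℓ' - ℓ| ≤ σ) :
    Tendsto (fun n => ∫ ω, g (S n ω) ∂μ) atTop (𝓝 ℓ) := by
  rw [Metric.tendsto_atTop]
  intro ε hε
  obtain ⟨δ, hδ, hδg⟩ := Metric.mem_uniformity_dist.1
    ((isCompact_Icc (a := -C) (b := C)).uniformContinuousAt_of_continuousAt g
      (fun a _ => g.continuous.continuousAt) (Metric.dist_mem_uniformity (half_pos (half_pos hε))))
  set σ := ε / (8 * (‖g‖ + 1)) with hσdef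
  have hg0 : 0 ≤ ‖g‖ := norm_nonneg g
  have hσ : 0 < σ := by positivity
  have hgσ : 2 * ‖g‖ * σ + σ ≤ ε / 4 := by
    have : σ * (8 * (‖g‖ + 1)) = ε := div_mul_cancel₀ _ (by positivity)
    nlinarith
  obtain ⟨T, hT, hTC, hST, ℓ', hℓ', hℓℓ'⟩ := happ σ hσ δ hδ
  obtain ⟨N, hN⟩ := eventually_atTop.1
    (hST.and (Metric.tendsto_nhds.1 hℓ' (ε / 4) (by positivity)))
  refine ⟨N, fun n hn => ?_⟩
  obtain ⟨h1, h2⟩ := hN n hn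
  have hgi : ∀ U : Ω → ℝ, Measurable U → Integrable (fun ω => g (U ω)) μ := fun U hU =>
    Integrable.of_bound (g.continuous.measurable.comp hU).aestronglyMeasurable ‖g‖
      (Eventually.of_forall fun ω => g.norm_coe_le_norm _)
  have h3 : ∫ ω, |g (S n ω) - g (T n ω)| ∂μ ≤ ε / 2 / 2 + (2 * ‖g‖) * σ := by
    refine (integral_abs_le_of_bdd (B := 2 * ‖g‖) (δ := ε / 2 / 2) (by positivity)
      (Eventually.of_forall fun ω => ?_)).trans ?_
    · rw [two_mul]
      exact (abs_sub _ _).trans (add_le_add (g.norm_coe_le_norm _) (g.norm_coe_le_norm _))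
    · gcongr
      refine (measureReal_mono fun ω hω => ?_).trans h1
      simp only [Set.mem_ofPred_eq] at hω ⊢
      by_contra! hlt
      have h4 := hδg (a := T n ω) (b := S n ω)
        (by rw [Real.dist_eq, abs_sub_comm]; exact hlt) (abs_le.1 (hTC n ω))
      simp only [Set.mem_ofPred_eq, Real.dist_eq] at h4
      rw [abs_sub_comm] at h4
      linarith
  have h5 : |(∫ ω, g (S n ω) ∂μ) - ∫ ω, g (T n ω) ∂μ| ≤ ∫ ω, |g (S n ω) - g (T n ω)| ∂μ := by
    rw [← integral_sub (hgi _ (hS n)) (hgi _ (hT n))]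
    exact abs_integral_le_integral_abs
  rw [Real.dist_eq] at h2 ⊢
  have h6 := abs_sub_le (∫ ω, g (S n ω) ∂μ) (∫ ω, g (T n ω) ∂μ) ℓ
  have h7 := abs_sub_le (∫ ω, g (T n ω) ∂μ) ℓ' ℓ
  linarith

lemma measureReal_le_of_integral_sq_le {Q : Ω → ℝ} (hQ : Integrable (fun ω => Q ω ^ 2) μ)
    {θ δ σ : ℝ} (hδ : 0 < δ) (hθ : ∫ ω, Q ω ^ 2 ∂μ ≤ θ) (hθσ : θ ≤ δ ^ 2 * σ) :
    μ.real {ω | δ ≤ |Q ω|} ≤ σ := by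
  have h1 := mul_meas_ge_le_integral_of_nonneg
    (Eventually.of_forall fun ω => sq_nonneg (Q ω)) hQ (δ ^ 2)
  have h2 : μ.real {ω | δ ≤ |Q ω|} ≤ μ.real {ω | δ ^ 2 ≤ Q ω ^ 2} :=
    measureReal_mono fun ω (hω : δ ≤ |Q ω|) => by
      simpa using pow_le_pow_left₀ hδ.le hω 2
  have h3 : 0 < δ ^ 2 := by positivity
  exact h2.trans (le_of_mul_le_mul_left (h1.trans (hθ.trans hθσ)) h3)

end Approximation

lemma comp_affine_ae_eq_of_map_absolutelyContinuous {Ω : Type*} [m : MeasurableSpace Ω]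
    {μ : Measure Ω} {Y : Ω → ℝ} (hY : Measurable Y) (hac : Measure.map Y μ ≪ volume)
    {K K' : ℝ → ℝ} (hKK' : K =ᵐ[volume] K') {a : ℝ} (ha : a ≠ 0) (b : ℝ) :
    (fun ω => K (a * Y ω + b)) =ᵐ[μ] fun ω => K' (a * Y ω + b) := by
  have hmul : Measure.QuasiMeasurePreserving (fun y : ℝ => a * y) := by
    refine ⟨measurable_const_mul a, ?_⟩
    rw [Real.map_volume_mul_left ha]
    exact Measure.smul_absolutelyContinuous
  have hadd := (measurePreserving_add_right (volume : Measure ℝ) b).quasiMeasurePreserving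
  have hYq : Measure.QuasiMeasurePreserving Y μ volume := ⟨hY, hac⟩
  exact hKK'.comp_tendsto (hadd.comp (hmul.comp hYq)).tendsto_ae

/-- **Theorem 3.3 (kernel functionals of weakly nonstationary processes,
high-level conditions).**  Under Assumption K and HL0–HL2, HL4, HL6–HL9, if the
bandwidth satisfies `β_n⁻¹ h_n + β_n (n h_n)⁻¹ → 0` and the initial terms are
negligible, then `(β_n/(h_n n)) ∑_{t=1}^n K((X_t(n) − x)/h_n)` converges in
distribution to `Φ_{X⁺}(−X⁻) ∫ K`. -/
theorem main_kernel_HL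
    {Ω : Type*} [m : MeasurableSpace Ω] (μ : Measure Ω) [IsProbabilityMeasure μ]
    -- HL0 (with the convention X_0(n) = 0)
    (F : ℤ → MeasurableSpace Ω) (hFmono : Monotone F) (hFle : ∀ i, F i ≤ m)
    (X Xp Xm R : ℕ → ℕ → Ω → ℝ)
    (hXmeas : ∀ n t, Measurable (X n t))
    (hXadapted : ∀ (n t : ℕ), Measurable[F (t : ℤ)] (X n t))
    (hX0 : ∀ n ω, X n 0 ω = 0)
    (β : ℕ → ℝ) (hβpos : ∀ n, 0 < β n) (hβ : Tendsto β atTop atTop)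
    -- HL1
    (hdecomp : ∀ n t ω, X n t ω = Xp n t ω + Xm n t ω + R n t ω)
    (hXmF0 : ∀ n t, Measurable[F 0] (Xm n t))
    (hRneg : ∀ ε : ℝ, 0 < ε → ∀ δ : ℝ, 0 < δ → ∃ N, ∀ n, N ≤ n →
      ∀ t, 1 ≤ t → t ≤ n → (μ {ω | ε < (β n)⁻¹ * |R n t ω|}).toReal ≤ δ)
    -- HL2
    (Xminus : Ω → ℝ) (hXminusMeas : Measurable Xminus)
    (Φ : ℝ → ℝ) (hΦcont : Continuous Φ) (hΦbdd : ∃ C, ∀ y, Φ y ≤ C)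
    (hΦdens : ∀ y, 0 ≤ Φ y)
    (hHL2a : ∀ δ : ℝ, 0 < δ → δ < 1 → ∀ tseq : ℕ → ℕ,
      (∀ n : ℕ, ⌊(n : ℝ) * δ⌋₊ ≤ tseq n ∧ tseq n ≤ n) →
      ∀ h : ℝ →ᵇ ℝ,
        TendstoInMeasure μ
          (fun n => μ[fun ω => h ((β n)⁻¹ * Xp n (tseq n) ω) | F 0]) atTop
          (fun _ => ∫ y, h y * Φ y))
    (hHL2b : ∀ δ : ℝ, 0 < δ → δ < 1 → ∀ tseq : ℕ → ℕ,
      (∀ n : ℕ, ⌊(n : ℝ) * δ⌋₊ ≤ tseq n ∧ tseq n ≤ n) →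
      (∀ h : ℝ →ᵇ ℝ,
        Tendsto (fun n => ∫ ω, h ((β n)⁻¹ * Xm n (tseq n) ω) ∂μ) atTop
          (𝓝 (∫ ω, h (Xminus ω) ∂μ))) ∧
      TendstoInMeasure μ
        (fun (n : ℕ) ω => (β n)⁻¹ * (Xm n n ω - Xm n (tseq n) ω)) atTop
        (fun _ => 0))
    -- HL4
    (hHL4 : ∀ (L : NNReal) (g : ℝ → ℝ), LipschitzWith L g → (∃ C, ∀ y, |g y| ≤ C) →
      TendstoInMeasure μ
        (fun (n : ℕ) ω => (n : ℝ)⁻¹ * ∑ t ∈ Icc 1 n,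
          (g ((β n)⁻¹ * X n t ω) -
            (μ[fun ω' => g ((β n)⁻¹ * X n t ω') | F 0]) ω))
        atTop (fun _ => 0))
    -- HL7: conditional densities of the (scaled) increments
    (t₀ n₀ : ℕ) (ht₀ : 1 ≤ t₀) (hn₀ : 1 ≤ n₀)
    (D : ℕ → ℕ → ℕ → Ω → ℝ → ℝ)   -- D n t s ω y
    (hD : ∀ (n t s : ℕ), s < t → t ≤ n →
      ∀ ψ : ℝ → ℝ, Measurable ψ → (∃ C, ∀ y, |ψ y| ≤ C) →
        μ[fun ω => ψ ((β (t - s))⁻¹ * (X n t ω - X n s ω)) | F (s : ℤ)]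
          =ᵐ[μ] fun ω => ∫ y, ψ y * D n t s ω y)
    (hD7 : ∃ C, ∀ n, n₀ ≤ n → ∀ (t s : ℕ), s < t → t ≤ n → t₀ ≤ t - s →
      ∀ ω y, D n t s ω y ≤ C)
    -- HL6
    (hHL6 : ∃ C, ∀ n : ℕ, 1 ≤ n → (β n / n) * ∑ t ∈ Icc t₀ n, (β t)⁻¹ ≤ C)
    -- HL8
    (hHL8 : ∀ q₀ q₁ : ℝ, 0 < q₀ → 0 < q₁ → ∀ ε : ℝ, 0 < ε →
      ∃ η₀ : ℝ, 0 < η₀ ∧ ∀ η : ℝ, 0 < η → η < η₀ → ∃ N : ℕ, ∀ n, N ≤ n →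
        ∀ s t : ℕ, (⌊η * n⌋₊ ≤ s ∧ s ≤ ⌊(1 - η) * n⌋₊ ∧ ⌊η * n⌋₊ + s ≤ t ∧ t ≤ n) →
          ∀ ω y, |y| ≤ q₀ * η ^ q₁ → |D n t s ω y - D n t s ω 0| ≤ ε)
    -- HL9
    (hHL9a : ∀ ε : ℝ, 0 < ε → ∃ η₀ : ℝ, 0 < η₀ ∧ ∀ η : ℝ, 0 < η → η < η₀ →
      ∃ N : ℕ, ∀ n, N ≤ n →
        (β n / n) * ∑ t ∈ Icc (⌊(1 - η) * (n : ℝ)⌋₊) n, (β t)⁻¹ ≤ ε)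
    (hHL9b : ∀ ε : ℝ, 0 < ε → ∃ η₀ : ℝ, 0 < η₀ ∧ ∀ η : ℝ, 0 < η → η < η₀ →
      ∃ N : ℕ, ∀ n, N ≤ n →
        (β n / n) * ∑ t ∈ Icc t₀ (⌊η * (n : ℝ)⌋₊), (β t)⁻¹ ≤ ε)
    (hHL9c : ∃ C : ℝ, ∃ N : ℕ, ∀ n, N ≤ n →
      (β n / n) * ∑ t ∈ Icc t₀ n, (β t)⁻¹ ≤ C)
    (hHL9d : ∃ l₀ l₁ : ℝ, 0 < l₀ ∧ 0 < l₁ ∧ ∀ η : ℝ, 0 < η → η < 1 →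
      ∀ ε : ℝ, 0 < ε → ∃ N : ℕ, ∀ n, N ≤ n →
        ∀ s t : ℕ, (⌊η * n⌋₊ ≤ s ∧ s ≤ ⌊(1 - η) * n⌋₊ ∧ ⌊η * n⌋₊ + s ≤ t ∧ t ≤ n) →
          η ^ l₁ / l₀ - ε ≤ (β n)⁻¹ * β (t - s))
    (hHL9e : ∃ C, ∀ n : ℕ, 1 ≤ n → ∀ t, 1 ≤ t → t ≤ n → β t ≤ C * β n)
    -- Assumption K
    (K : ℝ → ℝ) (hK : Integrable K volume) (hK2 : Integrable (fun y => (K y) ^ 2) volume)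
    -- (i): bandwidth
    (h : ℕ → ℝ) (hhpos : ∀ n, 0 < h n)
    (hband : Tendsto (fun n => (β n)⁻¹ * h n + β n * ((n : ℝ) * h n)⁻¹) atTop (𝓝 0))
    -- (ii): negligibility of the initial terms
    (hinit : ∀ x : ℝ,
      TendstoInMeasure μ
        (fun (n : ℕ) ω => (β n / ((n : ℝ) * h n)) *
          ∑ t ∈ Ico 1 t₀, K ((X n t ω - x) / h n))
        atTop (fun _ => 0)) :
    -- conclusion
    ∀ x : ℝ, ∀ g : ℝ →ᵇ ℝ,
      Tendsto
        (fun n : ℕ =>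
          ∫ ω, g ((β n / (h n * n)) * ∑ t ∈ Icc 1 n, K ((X n t ω - x) / h n)) ∂μ)
        atTop
        (𝓝 (∫ ω, g (Φ (-(Xminus ω)) * ∫ y, K y) ∂μ)) := by
  intro x g
  obtain ⟨CΦ, hCΦ⟩ := hΦbdd
  set κ : ℝ := ∫ y, K y with hκ
  obtain ⟨K', hK'm, hKK'⟩ : ∃ K' : ℝ → ℝ, Measurable K' ∧ K =ᵐ[volume] K' :=
    ⟨hK.1.mk K, hK.1.stronglyMeasurable_mk.measurable, hK.1.ae_eq_mk⟩
  have hK'i : Integrable K' := hK.congr hKK'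
  have hK'2 : Integrable fun u => K' u ^ 2 :=
    hK2.congr (hKK'.mono fun u hu => by simp only [hu])
  have hκ' : ∫ y, K' y = κ := (integral_congr_ae hKK').symm
  have hae : ∀ n t, 1 ≤ t → t ≤ n →
      (fun ω => K ((X n t ω - x) / h n)) =ᵐ[μ] fun ω => K' ((X n t ω - x) / h n) := by
    intro n t ht htn
    have hac := map_absolutelyContinuous_of_condDensity (hFle ((0 : ℕ) : ℤ)) μ
      (((hXmeas n t).sub (hXmeas n 0)).const_mul _) (hD n t 0 ht htn)
    have hb := (hβpos (t - 0)).ne'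
    have hh := (hhpos n).ne'
    have := comp_affine_ae_eq_of_map_absolutelyContinuous
      (((hXmeas n t).sub (hXmeas n 0)).const_mul _) hac hKK' (div_ne_zero hb hh) (-x / h n)
    convert this using 3 with ω ω <;>
    · rw [Pi.sub_apply, hX0]
      field_simp
      ring
  have hband1 : Tendsto (fun n => (β n)⁻¹ * h n) atTop (𝓝 0) :=
    squeeze_zero (fun n => mul_nonneg (inv_nonneg.2 (hβpos n).le) (hhpos n).le)
      (fun n => le_add_of_nonneg_right (mul_nonneg (hβpos n).le
        (inv_nonneg.2 (mul_nonneg n.cast_nonneg (hhpos n).le)))) hband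
  have hband2 : Tendsto (fun n => β n * ((n : ℝ) * h n)⁻¹) atTop (𝓝 0) :=
    squeeze_zero (fun n => mul_nonneg (hβpos n).le
        (inv_nonneg.2 (mul_nonneg n.cast_nonneg (hhpos n).le)))
      (fun n => le_add_of_nonneg_left (mul_nonneg (inv_nonneg.2 (hβpos n).le) (hhpos n).le)) hband
  have hinit' : TendstoInMeasure μ (fun (n : ℕ) ω => (β n / ((n : ℝ) * h n)) *
      ∑ t ∈ Ico 1 t₀, K' ((X n t ω - x) / h n)) atTop (fun _ => 0) := by
    refine (hinit x).congr' ?_ (Eventually.of_forall fun _ => rfl)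
    filter_upwards [eventually_ge_atTop t₀] with n hn
    have := (Ico 1 t₀).eventually_all.2 fun t ht =>
      hae n t (mem_Ico.1 ht).1 ((mem_Ico.1 ht).2.le.trans hn)
    filter_upwards [this] with ω hω
    rw [sum_congr rfl hω]
  have hKS : ∀ n t, Measurable fun ω => K' ((X n t ω - x) / h n) := fun n t =>
    hK'm.comp (((hXmeas n t).sub_const x).div_const _)
  suffices hmain : Tendsto (fun n : ℕ =>
      ∫ ω, g ((β n / (h n * n)) * ∑ t ∈ Icc 1 n, K' ((X n t ω - x) / h n)) ∂μ) atTop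
      (𝓝 (∫ ω, g (Φ (-(Xminus ω)) * κ) ∂μ)) by
    refine hmain.congr fun n => integral_congr_ae ?_
    have := (Icc 1 n).eventually_all.2 fun t ht => hae n t (mem_Icc.1 ht).1 (mem_Icc.1 ht).2
    filter_upwards [this] with ω hω
    rw [sum_congr rfl hω]
  have hmoll : ∀ ε : ℝ, ∃ f : ℝ → ℝ, 0 < ε → Continuous f ∧ Integrable f ∧ (∀ y, 0 ≤ f y) ∧
      ∫ y, f y = 1 ∧ (∃ M, ∀ y, f y ≤ M) ∧ (∀ y, ε < |y| → f y = 0) ∧ ∃ L, LipschitzWith L f := by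
    intro ε
    by_cases hε : 0 < ε
    · obtain ⟨f, hf⟩ := exists_lipschitz_mollifier hε
      exact ⟨f, fun _ => hf⟩
    · exact ⟨0, fun h => absurd h hε⟩
  choose φ hφ using hmoll
  have hGC : ∀ ε, 0 < ε → ∀ a, |∫ y, φ ε (y + a) * Φ y| ≤ CΦ := fun ε hε =>
    abs_integral_mollifier_mul_le (hφ ε hε).2.1 (hφ ε hε).2.2.1 (hφ ε hε).2.2.2.1 hΦdens hCΦ
  have hlast : ∀ n : ℕ, ⌊(n : ℝ) * (1 / 2)⌋₊ ≤ n ∧ n ≤ n := fun n =>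
    ⟨Nat.floor_le_of_le (mul_le_of_le_one_right n.cast_nonneg (by norm_num)), le_rfl⟩
  obtain ⟨hΦi, hΦ1, -⟩ := density_of_condExp_weak_limit (hFle 0) hΦdens
    (hHL2a (1 / 2) (by norm_num) (by norm_num) (fun n => n) hlast)
  have hGcont : ∀ ε, 0 < ε → Continuous fun a => ∫ y, φ ε (y + a) * Φ y := by
    intro ε hε
    obtain ⟨hfc, -, hf0, -, ⟨M, hM⟩, -, L, hL⟩ := hφ ε hε
    exact continuous_integral_comp_add_mul (B := M) (L := L) hfc
      (fun y => by rw [abs_of_nonneg (hf0 y)]; exact hM y)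
      (fun y z => by simpa [Real.dist_eq] using hL.dist_le_mul y z) hΦi hΦdens hΦ1
  have hscale : Tendsto (fun ε => ∫ ω, g (κ * ∫ y, φ ε (y + Xminus ω) * Φ y) ∂μ) (𝓝[>] 0)
      (𝓝 (∫ ω, g (Φ (-(Xminus ω)) * κ) ∂μ)) := by
    refine tendsto_integral_filter_of_dominated_convergence (fun _ => ‖g‖) ?_
      (Eventually.of_forall fun ε => Eventually.of_forall fun ω => g.norm_coe_le_norm _)
      (integrable_const _) (Eventually.of_forall fun ω => ?_)
    · filter_upwards [self_mem_nhdsWithin] with ε hε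
      exact ((g.continuous.comp (continuous_const.mul (hGcont ε hε))).measurable.comp
        hXminusMeas).aestronglyMeasurable
    · rw [mul_comm]
      exact (g.continuous.tendsto _).comp ((tendsto_integral_mollifier_mul
        (fun ε hε => (hφ ε hε).2.1) (fun ε hε => (hφ ε hε).2.2.1)
        (fun ε hε => (hφ ε hε).2.2.2.1) (fun ε hε => (hφ ε hε).2.2.2.2.2.1) hΦcont hΦdens
        hCΦ (Xminus ω)).const_mul κ)
  refine tendsto_integral_of_approx_in_measure (C := |κ| * CΦ)
    (fun n => (Finset.measurable_sum _ fun t _ => hKS n t).const_mul _) g fun σ hσ δ hδ => ?_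
  obtain ⟨ε₁, hε₁, hε₁σ⟩ := mem_nhdsGT_iff_exists_Ioo_subset.1
    (hscale (Metric.closedBall_mem_nhds _ hσ))
  obtain ⟨ε, hε, hεε₁, hQ⟩ := exists_scale_integral_sq_kernel_average_le μ F hFle X hXadapted
    β hβpos hβ t₀ n₀ ht₀ D hD hD7 hHL6 hHL8 hHL9a hHL9b hHL9d hK'm hK'i hK'2 h hhpos hband1 hband2
    x (θ := (δ / 2) ^ 2 * (σ / 2)) (by positivity) hε₁
  obtain ⟨hfc, hfi, hf0, hf1, ⟨M, hM⟩, hfε, L, hL⟩ := hφ ε hε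
  obtain ⟨N, hN⟩ := hQ (φ ε) hfc.measurable hfi hf0 hf1 ⟨M, hM⟩ hfε
  have hfM : ∀ y, |φ ε y| ≤ M := fun y => by rw [abs_of_nonneg (hf0 y)]; exact hM y
  have hU := tendstoInMeasure_average_sub_mixture (hFle 0) hXmeas hβpos hdecomp hXmF0 hRneg
    hXminusMeas hΦdens hHL2a hHL2b hfc hfM
    (fun y z => by simpa [Real.dist_eq] using hL.dist_le_mul y z) (hHL4 L (φ ε) hL ⟨M, hfM⟩)
  have hfirst : TendstoInMeasure μ (fun (n : ℕ) ω => (n : ℝ)⁻¹ *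
      ∑ t ∈ Ico 1 t₀, φ ε ((β n)⁻¹ * X n t ω)) atTop (fun _ => 0) := by
    refine tendstoInMeasure_of_tendsto_ae (fun n => ((Finset.measurable_sum _ fun t _ =>
      hfc.measurable.comp ((hXmeas n t).const_mul _)).const_mul _).aestronglyMeasurable)
      (Eventually.of_forall fun ω => ?_)
    have hlim : Tendsto (fun n : ℕ => (n : ℝ)⁻¹ * ∑ t ∈ Ico 1 t₀, M) atTop (𝓝 0) := by
      simpa using (tendsto_inv_atTop_nhds_zero_nat (𝕜 := ℝ)).mul_const (∑ t ∈ Ico 1 t₀, M)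
    refine squeeze_zero (fun n => mul_nonneg (by positivity) (sum_nonneg fun t _ => hf0 _))
      (fun n => mul_le_mul_of_nonneg_left (sum_le_sum fun t _ => hM _) (by positivity)) hlim
  have hW := tendstoInMeasure_zero_add hinit' (tendstoInMeasure_zero_add
    (tendstoInMeasure_zero_const_mul κ hU) (tendstoInMeasure_zero_const_mul (-κ) hfirst))
  have hZm : ∀ n, Measurable fun ω => (β n)⁻¹ * Xm n n ω := fun n =>
    ((hXmF0 n n).mono (hFle 0) le_rfl).const_mul _
  let ψ : ℝ →ᵇ ℝ := BoundedContinuousFunction.ofNormedAddCommGroup _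
    (g.continuous.comp (continuous_const.mul (hGcont ε hε) :
      Continuous fun a => κ * ∫ y, φ ε (y + a) * Φ y)) ‖g‖ fun a => g.norm_coe_le_norm _
  refine ⟨fun n ω => κ * ∫ y, φ ε (y + (β n)⁻¹ * Xm n n ω) * Φ y,
    fun n => ((hGcont ε hε).measurable.comp (hZm n)).const_mul κ, fun n ω => ?_, ?_,
    ∫ ω, g (κ * ∫ y, φ ε (y + Xminus ω) * Φ y) ∂μ,
    (hHL2b (1 / 2) (by norm_num) (by norm_num) (fun n => n) hlast).1 ψ,
    hε₁σ ⟨hε, hεε₁⟩⟩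
  · rw [abs_mul]
    exact mul_le_mul_of_nonneg_left (hGC ε hε _) (abs_nonneg κ)
  rw [tendstoInMeasure_iff_measureReal_norm] at hW
  filter_upwards [eventually_ge_atTop N, eventually_ge_atTop t₀,
    (hW (δ / 2) (half_pos hδ)).eventually_lt_const (half_pos hσ)] with n hnN hnt hnW
  have hn0 : (n : ℝ) ≠ 0 := by exact_mod_cast (show n ≠ 0 by omega)
  have hQn := measureReal_le_of_integral_sq_le (hN n hnN).1 (half_pos hδ) (hN n hnN).2 le_rfl
  rw [← add_halves σ]
  refine le_trans ((measureReal_mono fun ω hω => ?_).trans (measureReal_union_le _ _))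
    (add_le_add hQn hnW.le)
  simp only [Set.mem_ofPred_eq, Set.mem_union, sub_zero, Real.norm_eq_abs] at hω ⊢
  have hsplit : ∀ w : ℕ → ℝ, ∑ t ∈ Icc 1 n, w t = ∑ t ∈ Ico 1 t₀, w t + ∑ t ∈ Icc t₀ n, w t := by
    intro w
    rw [← Finset.Ico_add_one_right_eq_Icc, ← Finset.Ico_add_one_right_eq_Icc,
      sum_Ico_consecutive _ ht₀ (by omega)]
  have hdec : (β n / (h n * n)) * ∑ t ∈ Icc 1 n, K' ((X n t ω - x) / h n) -
      κ * ∫ y, φ ε (y + (β n)⁻¹ * Xm n n ω) * Φ y =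
      (n : ℝ)⁻¹ * ∑ t ∈ Icc t₀ n, kernelContrast K' (φ ε) x (β n) (h n) (X n t ω) +
      ((β n / (n * h n)) * ∑ t ∈ Ico 1 t₀, K' ((X n t ω - x) / h n) +
        (κ * ((n : ℝ)⁻¹ * ∑ t ∈ Icc 1 n, φ ε ((β n)⁻¹ * X n t ω) -
          ∫ y, φ ε (y + (β n)⁻¹ * Xm n n ω) * Φ y) +
        -κ * ((n : ℝ)⁻¹ * ∑ t ∈ Ico 1 t₀, φ ε ((β n)⁻¹ * X n t ω)))) := by
    have hh := (hhpos n).ne'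
    simp only [kernelContrast, sum_sub_distrib, ← mul_sum, hκ', hsplit, div_eq_inv_mul (X n _ ω)]
    field_simp
    ring
  rw [hdec] at hω
  by_contra! hcon
  linarith [abs_add_le
    ((n : ℝ)⁻¹ * ∑ t ∈ Icc t₀ n, kernelContrast K' (φ ε) x (β n) (h n) (X n t ω))
    ((β n / (n * h n)) * ∑ t ∈ Ico 1 t₀, K' ((X n t ω - x) / h n) +
        (κ * ((n : ℝ)⁻¹ * ∑ t ∈ Icc 1 n, φ ε ((β n)⁻¹ * X n t ω) -
          ∫ y, φ ε (y + (β n)⁻¹ * Xm n n ω) * Φ y) +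
        -κ * ((n : ℝ)⁻¹ * ∑ t ∈ Ico 1 t₀, φ ε ((β n)⁻¹ * X n t ω))))]
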